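/- arXiv:math/9908163 — 12 statements merged into one kernel-verified Lean document; each statement's English description precedes it below -/
import Mathlib

section
/- For all nonnegative integers i, j with j ≤ i, and for any a and x, one has ∑_{k=j}^{i} C_{i-k}^{(-a)}(-x) · C_{k-j}^{(a)}(x) = δ_{ij} (Kronecker delta). Equivalently, ∑_{k=0}^{n} C_k^{(a)}(x) C_{n-k}^{(-a)}(-x) equals 1 if n = 0 and 0 if n ≥ 1. -/
/-- The Charlier polynomial `C_n^{(a)}(x) = ∑_{k=0}^{n} (-a)^{n-k}/(n-k)! ·
x(x-1)⋯(x-k+1)/k!`. -/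
noncomputable def charlier (a : ℝ) (n : ℕ) (x : ℝ) : ℝ :=
  ∑ k ∈ Finset.range (n + 1),
    (-a) ^ (n - k) / (Nat.factorial (n - k)) *
      ((∏ m ∈ Finset.range k, (x - m)) / (Nat.factorial k))

theorem Ring.choose_eq_prod_range_div_factorial {K : Type*} [Field K] [CharZero K] (x : K)
    (k : ℕ) : Ring.choose x k = (∏ m ∈ Finset.range k, (x - m)) / (Nat.factorial k) := by
  rw [Ring.choose_eq_smul, ← Polynomial.aeval_eq_smeval, Polynomial.aeval_def,
    Polynomial.eval₂_eq_eval_map, descPochhammer_map, descPochhammer_eval_eq_prod_range,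
    smul_eq_mul, div_eq_inv_mul]

/-- The generating function `(1 + t)^x e^{-at}` of the Charlier polynomials. -/
theorem mk_charlier_eq_binomialSeries_mul_exp (a x : ℝ) :
    PowerSeries.mk (fun n => charlier a n x) =
      PowerSeries.binomialSeries ℝ x * PowerSeries.rescale (-a) (PowerSeries.exp ℝ) := by
  ext n
  rw [PowerSeries.coeff_mk, PowerSeries.coeff_mul,
    Finset.Nat.sum_antidiagonal_eq_sum_range_succ_mk, charlier]
  refine Finset.sum_congr rfl fun k _ => ?_
  simp [PowerSeries.coeff_rescale, PowerSeries.coeff_exp,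
    Ring.choose_eq_prod_range_div_factorial, div_eq_mul_inv]
  ring

theorem mk_charlier_mul_mk_charlier_neg (a x : ℝ) :
    PowerSeries.mk (fun n => charlier a n x) * PowerSeries.mk (fun n => charlier (-a) n (-x)) =
      1 := by
  rw [mk_charlier_eq_binomialSeries_mul_exp, mk_charlier_eq_binomialSeries_mul_exp,
    mul_mul_mul_comm, ← PowerSeries.binomialSeries_add, PowerSeries.exp_mul_exp_eq_exp_add]
  simp

theorem sum_charlier_mul_charlier_neg (a x : ℝ) (n : ℕ) :
    ∑ k ∈ Finset.range (n + 1), charlier a k x * charlier (-a) (n - k) (-x) =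
      if n = 0 then 1 else 0 := by
  have h := congrArg (PowerSeries.coeff n) (mk_charlier_mul_mk_charlier_neg a x)
  simpa only [PowerSeries.coeff_mul, PowerSeries.coeff_mk, PowerSeries.coeff_one,
    Finset.Nat.sum_antidiagonal_eq_sum_range_succ_mk] using h

/-- Inversion formula for the Charlier polynomials:
`∑_{k=j}^{i} C_{i-k}^{(-a)}(-x) C_{k-j}^{(a)}(x) = δ_{ij}`. -/
theorem charlier_inversion (a x : ℝ) (i j : ℕ) (hij : j ≤ i) :
    ∑ k ∈ Finset.Icc j i, charlier (-a) (i - k) (-x) * charlier a (k - j) x =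
      if i = j then 1 else 0 := by
  obtain ⟨n, rfl⟩ := Nat.exists_eq_add_of_le hij
  rw [← Finset.Ico_add_one_right_eq_Icc, Finset.sum_Ico_eq_sum_range, add_assoc,
    Nat.add_sub_cancel_left]
  simp only [Nat.add_sub_add_left, Nat.add_sub_cancel_left, Nat.add_eq_left]
  refine Eq.trans ?_ (sum_charlier_mul_charlier_neg a x n)
  exact Finset.sum_congr rfl fun k _ => mul_comm _ _
end

section
/- For all nonnegative integers i, j with j ≤ i, and for any real α and real x, one has ∑_{k=j}^{i} L_{i-k}^{(-α-i-1)}(-x) · L_{k-j}^{(α+j)}(x) = δ_{ij} (Kronecker delta). -/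
/-- The Laguerre polynomial with arbitrary real parameter `α`:
`L_n^{(α)}(x) = ∑_{k=0}^{n} (-1)^k (α+k+1)_{n-k}/(n-k)! · x^k/k!`. -/
noncomputable def laguerre (α : ℝ) (n : ℕ) (x : ℝ) : ℝ :=
  ∑ k ∈ Finset.range (n + 1),
    (-1 : ℝ) ^ k * ((ascPochhammer ℝ (n - k)).eval (α + k + 1) / (Nat.factorial (n - k))) *
      (x ^ k / (Nat.factorial k))

/-- The Chu–Vandermonde identity for rising factorials divided by factorials. -/
theorem sum_antidiagonal_ascPochhammer_div_factorial (a b : ℝ) (n : ℕ) :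
    ∑ p ∈ Finset.HasAntidiagonal.antidiagonal n,
        ((ascPochhammer ℝ p.1).eval a / p.1.factorial) *
          ((ascPochhammer ℝ p.2).eval b / p.2.factorial) =
      (ascPochhammer ℝ n).eval (a + b) / n.factorial := by
  have key (c : ℝ) (m : ℕ) :
      (ascPochhammer ℝ m).eval c / m.factorial = (-1) ^ m * Ring.choose (-c) m := by
    have h := Polynomial.ascPochhammer_smeval_neg_eq_descPochhammer (-c) m
    rw [neg_neg, Polynomial.ascPochhammer_smeval_eq_eval] at h
    rw [h, Ring.choose_eq_smul, Int.negOnePow_def, zpow_natCast, Units.smul_def, zsmul_eq_mul,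
      smul_eq_mul]
    push_cast
    ring
  rw [key, neg_add, Ring.add_choose_eq n (Commute.all _ _), Finset.mul_sum]
  refine Finset.sum_congr rfl fun p hp => ?_
  rw [key, key, ← Finset.HasAntidiagonal.mem_antidiagonal.1 hp, pow_add]
  ring

theorem laguerre_eq_sum_antidiagonal (α : ℝ) (n : ℕ) (x : ℝ) :
    laguerre α n x = ∑ p ∈ Finset.HasAntidiagonal.antidiagonal n,
      ((-x) ^ p.1 / p.1.factorial) *
        ((ascPochhammer ℝ p.2).eval (α + p.1 + 1) / p.2.factorial) := by
  rw [laguerre, Finset.Nat.sum_antidiagonal_eq_sum_range_succ_mk]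
  refine Finset.sum_congr rfl fun k _ => ?_
  rw [neg_pow x k]
  ring

theorem sum_antidiagonal_antidiagonal_exchange {M : Type*} [AddCommMonoid M]
    (f : ℕ → ℕ → ℕ → ℕ → M) (n : ℕ) :
    ∑ p ∈ Finset.HasAntidiagonal.antidiagonal n, ∑ q ∈ Finset.HasAntidiagonal.antidiagonal p.1,
        ∑ r ∈ Finset.HasAntidiagonal.antidiagonal p.2, f q.1 q.2 r.1 r.2 =
      ∑ p ∈ Finset.HasAntidiagonal.antidiagonal n, ∑ q ∈ Finset.HasAntidiagonal.antidiagonal p.1,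
        ∑ r ∈ Finset.HasAntidiagonal.antidiagonal p.2, f q.1 r.1 q.2 r.2 := by
  simp only [← Finset.sum_product', Finset.sum_sigma']
  refine Finset.sum_nbij'
    (fun s => ⟨(s.2.1.1 + s.2.2.1, s.2.1.2 + s.2.2.2),
      ((s.2.1.1, s.2.2.1), (s.2.1.2, s.2.2.2))⟩)
    (fun s => ⟨(s.2.1.1 + s.2.2.1, s.2.1.2 + s.2.2.2),
      ((s.2.1.1, s.2.2.1), (s.2.1.2, s.2.2.2))⟩) ?_ ?_ ?_ ?_ ?_
  · rintro ⟨⟨p, m⟩, ⟨r, s⟩, ⟨u, v⟩⟩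
    simp
    omega
  · rintro ⟨⟨p, m⟩, ⟨r, s⟩, ⟨u, v⟩⟩
    simp
    omega
  · rintro ⟨⟨p, m⟩, ⟨r, s⟩, ⟨u, v⟩⟩
    simp +contextual
  · rintro ⟨⟨p, m⟩, ⟨r, s⟩, ⟨u, v⟩⟩
    simp +contextual
  · simp

theorem sum_antidiagonal_pow_div_factorial (x y : ℝ) (n : ℕ) :
    ∑ p ∈ Finset.HasAntidiagonal.antidiagonal n, (x ^ p.1 / p.1.factorial) * (y ^ p.2 / p.2.factorial) =
      (x + y) ^ n / n.factorial := by
  rw [(Commute.all x y).add_pow', Finset.sum_div]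
  refine Finset.sum_congr rfl fun p hp => ?_
  obtain rfl := Finset.HasAntidiagonal.mem_antidiagonal.1 hp
  rw [nsmul_eq_mul, Nat.cast_add_choose]
  have h := Nat.factorial_ne_zero (p.1 + p.2)
  field_simp

/-- The addition formula for Laguerre polynomials. -/
theorem sum_antidiagonal_laguerre_mul (α β x y : ℝ) (n : ℕ) :
    ∑ p ∈ Finset.HasAntidiagonal.antidiagonal n, laguerre α p.1 x * laguerre β p.2 y =
      laguerre (α + β + 1) n (x + y) := by
  simp only [laguerre_eq_sum_antidiagonal, Finset.sum_mul_sum]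
  rw [sum_antidiagonal_antidiagonal_exchange (fun a b c d =>
    ((-x) ^ a / a.factorial * ((ascPochhammer ℝ b).eval (α + a + 1) / b.factorial)) *
      ((-y) ^ c / c.factorial * ((ascPochhammer ℝ d).eval (β + c + 1) / d.factorial)))]
  refine Finset.sum_congr rfl fun p _ => ?_
  rw [neg_add, ← sum_antidiagonal_pow_div_factorial, Finset.sum_mul]
  refine Finset.sum_congr rfl fun q hq => ?_
  rw [← Finset.HasAntidiagonal.mem_antidiagonal.1 hq, Nat.cast_add,
    show α + β + 1 + ((q.1 : ℝ) + q.2) + 1 = (α + q.1 + 1) + (β + q.2 + 1) by ring,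
    ← sum_antidiagonal_ascPochhammer_div_factorial, Finset.mul_sum]
  exact Finset.sum_congr rfl fun r _ => by ring

theorem laguerre_zero_right (α : ℝ) (n : ℕ) :
    laguerre α n 0 = (ascPochhammer ℝ n).eval (α + 1) / n.factorial := by
  rw [laguerre, Finset.sum_range_succ']
  simp

/-- Inversion formula for the Laguerre polynomials:
`∑_{k=j}^{i} L_{i-k}^{(-α-i-1)}(-x) L_{k-j}^{(α+j)}(x) = δ_{ij}`. -/
theorem laguerre_inversion (α x : ℝ) (i j : ℕ) (hij : j ≤ i) :
    ∑ k ∈ Finset.Icc j i,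
        laguerre (-α - i - 1) (i - k) (-x) * laguerre (α + j) (k - j) x =
      if i = j then 1 else 0 := by
  obtain ⟨n, rfl⟩ := Nat.exists_eq_add_of_le hij
  have hsum : ∑ k ∈ Finset.Icc j (j + n),
      laguerre (-α - (j + n : ℕ) - 1) (j + n - k) (-x) * laguerre (α + j) (k - j) x =
      ∑ p ∈ Finset.HasAntidiagonal.antidiagonal n,
        laguerre (α + j) p.1 x * laguerre (-α - (j + n : ℕ) - 1) p.2 (-x) := by
    rw [Finset.Nat.sum_antidiagonal_eq_sum_range_succ_mk, ← Finset.Ico_add_one_right_eq_Icc,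
      Finset.sum_Ico_eq_sum_range, show j + n + 1 - j = n + 1 by omega]
    refine Finset.sum_congr rfl fun k _ => ?_
    rw [Nat.add_sub_add_left, Nat.add_sub_cancel_left, mul_comm]
  rw [hsum, sum_antidiagonal_laguerre_mul, add_neg_cancel, laguerre_zero_right, Nat.cast_add]
  cases n with
  | zero => simp
  | succ m =>
    rw [if_neg (by omega), show α + (j : ℝ) + (-α - (j + ((m + 1 : ℕ) : ℝ)) - 1) + 1 + 1 = -(m : ℝ)
      by push_cast; ring, ascPochhammer_eval_neg_coe_nat_of_lt (Nat.lt_succ_self m), zero_div]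
end

section
/- Let α be real, let {F_n}_{n=1}^∞ be a sequence of real polynomials, and suppose {a_i}_{i=1}^∞ is a sequence of real polynomials satisfying ∑_{i=1}^{n} a_i(x) · D^i L_n^{(α)}(x) = F_n(x) for all n = 1,2,3,… (the sum terminates since D^i L_n^{(α)} = 0 for i > n). Then the coefficients are uniquely determined and given by a_i(x) = (-1)^i ∑_{j=1}^{i} L_{i-j}^{(-α-i-1)}(-x) · F_j(x) for i = 1,2,3,…. -/
open Polynomial

/-- The Laguerre polynomial with arbitrary real parameter `α`, as a polynomial:
`L_n^{(α)}(x) = ∑_{k=0}^{n} (-1)^k (α+k+1)_{n-k}/(n-k)! · x^k/k!`. -/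
noncomputable def laguerrePoly (α : ℝ) (n : ℕ) : Polynomial ℝ :=
  ∑ k ∈ Finset.range (n + 1),
    Polynomial.C ((-1 : ℝ) ^ k * ((ascPochhammer ℝ (n - k)).eval (α + k + 1) /
      (Nat.factorial (n - k))) / (Nat.factorial k)) * Polynomial.X ^ k

/-- The power series of `(1 - X) ^ (-r)`. -/
noncomputable def negBinomialSeries (r : ℝ) : PowerSeries ℝ :=
  PowerSeries.rescale (-1 : ℝ) (PowerSeries.binomialSeries ℝ (-r))

theorem negBinomialSeries_add (r s : ℝ) :
    negBinomialSeries (r + s) = negBinomialSeries r * negBinomialSeries s := by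
  simp only [negBinomialSeries]
  rw [neg_add, PowerSeries.binomialSeries_add, map_mul]

theorem coeff_negBinomialSeries (r : ℝ) (n : ℕ) :
    PowerSeries.coeff n (negBinomialSeries r) =
      (ascPochhammer ℝ n).eval r / (Nat.factorial n) := by
  have h := Ring.factorial_nsmul_multichoose_eq_ascPochhammer r n
  rw [ascPochhammer_smeval_eq_eval, nsmul_eq_mul] at h
  have hn : (Nat.factorial n : ℝ) ≠ 0 := by positivity
  rw [← h, mul_div_cancel_left₀ _ hn, negBinomialSeries, PowerSeries.coeff_rescale,
    PowerSeries.binomialSeries_coeff, Ring.choose_neg', ← Int.cast_negOnePow_natCast,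
    Units.smul_def, zsmul_eq_mul, smul_eq_mul, mul_one, ← mul_assoc, ← Int.cast_mul,
    ← Units.val_mul, Int.units_mul_self]
  simp

theorem coeff_negBinomialSeries_neg_natCast (n : ℕ) :
    PowerSeries.coeff (n + 1) (negBinomialSeries (-n)) = 0 := by
  rw [negBinomialSeries, PowerSeries.coeff_rescale, PowerSeries.binomialSeries_coeff, neg_neg,
    Ring.choose_natCast]
  simp

theorem coeff_laguerrePoly (α : ℝ) (n k : ℕ) :
    (laguerrePoly α n).coeff k = (-1) ^ k / (Nat.factorial k) *
      PowerSeries.coeff n (PowerSeries.X ^ k * negBinomialSeries (α + k + 1)) := by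
  simp only [laguerrePoly, finsetSum_coeff, coeff_C_mul, coeff_X_pow, mul_ite, mul_one, mul_zero,
    Finset.sum_ite_eq, PowerSeries.coeff_X_pow_mul', coeff_negBinomialSeries, Finset.mem_range,
    Nat.lt_succ_iff]
  split_ifs
  · ring
  · rfl

theorem coeff_laguerrePoly_comp_neg_X (α : ℝ) (n k : ℕ) :
    ((laguerrePoly α n).comp (-X)).coeff k = 1 / (Nat.factorial k) *
      PowerSeries.coeff n (PowerSeries.X ^ k * negBinomialSeries (α + k + 1)) := by
  rw [show (-X : ℝ[X]) = C (-1) * X by simp, comp_C_mul_X_coeff, coeff_laguerrePoly, mul_right_comm,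
    div_mul_eq_mul_div, ← mul_pow]
  simp

theorem derivative_laguerrePoly_succ (α : ℝ) (n : ℕ) :
    derivative (laguerrePoly α (n + 1)) = -laguerrePoly (α + 1) n := by
  ext k
  have hk : (Nat.factorial k : ℝ) ≠ 0 := by positivity
  have hk' : (k : ℝ) + 1 ≠ 0 := by positivity
  rw [coeff_derivative, coeff_neg, coeff_laguerrePoly, coeff_laguerrePoly,
    pow_succ (-1 : ℝ), pow_succ' PowerSeries.X,
    mul_assoc PowerSeries.X, PowerSeries.coeff_succ_X_mul, Nat.factorial_succ]
  push_cast
  rw [show α + (k + 1) + 1 = α + 1 + k + 1 by ring]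
  field_simp

theorem iterate_derivative_laguerrePoly (i : ℕ) (α : ℝ) (n : ℕ) :
    derivative^[i] (laguerrePoly α (n + i)) = C ((-1) ^ i) * laguerrePoly (α + i) n := by
  induction i generalizing α with
  | zero => simp
  | succ i ih =>
    rw [Function.iterate_succ_apply, ← add_assoc, derivative_laguerrePoly_succ,
      iterate_derivative_neg, ih, pow_succ]
    push_cast
    rw [show α + 1 + i = α + (i + 1) by ring]
    simp

theorem sum_antidiagonal_neg_one_pow_div_factorial (k : ℕ) :
    ∑ p ∈ Finset.HasAntidiagonal.antidiagonal k,
      (1 / (Nat.factorial p.1) * ((-1) ^ p.2 / (Nat.factorial p.2)) : ℝ) =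
        if k = 0 then 1 else 0 := by
  have h := congrArg (PowerSeries.coeff k) (PowerSeries.exp_mul_exp_neg_eq_one (A := ℝ))
  rw [PowerSeries.coeff_mul, PowerSeries.coeff_one] at h
  rw [← h]
  refine Finset.sum_congr rfl fun p _ => ?_
  simp [PowerSeries.evalNegHom, PowerSeries.coeff_rescale, PowerSeries.coeff_exp, div_eq_mul_inv]

/-- The addition formula for Laguerre polynomials at opposite arguments, coefficient by
coefficient. -/
theorem coeff_sum_antidiagonal_laguerrePoly (β γ : ℝ) (n k : ℕ) :
    (∑ p ∈ Finset.HasAntidiagonal.antidiagonal n,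
      (laguerrePoly β p.1).comp (-X) * laguerrePoly γ p.2).coeff k =
        if k = 0 then PowerSeries.coeff n (negBinomialSeries (β + γ + 2)) else 0 := by
  have key : ∀ q ∈ Finset.HasAntidiagonal.antidiagonal k,
      ∑ p ∈ Finset.HasAntidiagonal.antidiagonal n,
      ((laguerrePoly β p.1).comp (-X)).coeff q.1 * (laguerrePoly γ p.2).coeff q.2 =
        (1 / (Nat.factorial q.1) * ((-1) ^ q.2 / (Nat.factorial q.2))) *
          PowerSeries.coeff n (PowerSeries.X ^ k * negBinomialSeries (β + γ + 2 + k)) := by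
    intro q hq
    rw [Finset.HasAntidiagonal.mem_antidiagonal] at hq
    have hs : PowerSeries.X ^ k * negBinomialSeries (β + γ + 2 + k) =
        (PowerSeries.X ^ q.1 * negBinomialSeries (β + q.1 + 1)) *
          (PowerSeries.X ^ q.2 * negBinomialSeries (γ + q.2 + 1)) := by
      rw [mul_mul_mul_comm, ← pow_add, ← negBinomialSeries_add, hq, ← hq]
      push_cast
      ring_nf
    rw [hs, PowerSeries.coeff_mul, Finset.mul_sum]
    refine Finset.sum_congr rfl fun p _ => ?_
    rw [coeff_laguerrePoly_comp_neg_X, coeff_laguerrePoly]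
    ring
  simp only [finsetSum_coeff, coeff_mul]
  rw [Finset.sum_comm, Finset.sum_congr rfl key, ← Finset.sum_mul,
    sum_antidiagonal_neg_one_pow_div_factorial]
  split_ifs with hk
  · simp [hk]
  · simp

theorem sum_antidiagonal_laguerrePoly_comp_neg_X_mul (β γ : ℝ) (n : ℕ) (h : β + γ + 1 = -n) :
    ∑ p ∈ Finset.HasAntidiagonal.antidiagonal n,
      (laguerrePoly β p.1).comp (-X) * laguerrePoly γ p.2 =
      if n = 0 then 1 else 0 := by
  ext k
  rw [coeff_sum_antidiagonal_laguerrePoly]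
  cases n with
  | zero => simp [coeff_negBinomialSeries, coeff_one]
  | succ n =>
    rw [show β + γ + 2 = -n by push_cast at h; linarith, coeff_negBinomialSeries_neg_natCast]
    simp

/-- If polynomials `a_i` satisfy `∑_{i=1}^{n} a_i(x) D^i L_n^{(α)}(x) = F_n(x)` for all
`n ≥ 1`, then they are uniquely determined, given by
`a_i(x) = (-1)^i ∑_{j=1}^{i} L_{i-j}^{(-α-i-1)}(-x) F_j(x)`. -/
theorem laguerre_system_solution (α : ℝ) (F a : ℕ → Polynomial ℝ)
    (ha : ∀ n : ℕ, 1 ≤ n →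
      ∑ i ∈ Finset.Icc 1 n, a i * (Polynomial.derivative^[i] (laguerrePoly α n)) = F n) :
    ∀ i : ℕ, 1 ≤ i →
      a i = Polynomial.C ((-1 : ℝ) ^ i) *
        ∑ j ∈ Finset.Icc 1 i,
          (laguerrePoly (-α - i - 1) (i - j)).comp (-Polynomial.X) * F j := by
  intro i hi
  have hF : ∀ j ∈ Finset.Icc 1 i, (laguerrePoly (-α - i - 1) (i - j)).comp (-X) * F j =
      ∑ k ∈ Finset.Icc 1 j, a k * C ((-1) ^ k) *
        ((laguerrePoly (-α - i - 1) (i - j)).comp (-X) * laguerrePoly (α + k) (j - k)) := by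
    intro j hj
    rw [← ha j (Finset.mem_Icc.1 hj).1, Finset.mul_sum]
    refine Finset.sum_congr rfl fun k hk => ?_
    have h := iterate_derivative_laguerrePoly k α (j - k)
    rw [Nat.sub_add_cancel (Finset.mem_Icc.1 hk).2] at h
    rw [h]
    ring
  have hinner : ∀ k ∈ Finset.Icc 1 i, ∑ j ∈ Finset.Icc k i,
      (laguerrePoly (-α - i - 1) (i - j)).comp (-X) * laguerrePoly (α + k) (j - k) =
        if k = i then 1 else 0 := by
    intro k hk
    have hki := (Finset.mem_Icc.1 hk).2
    have h := sum_antidiagonal_laguerrePoly_comp_neg_X_mul (-α - i - 1) (α + k) (i - k)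
      (by rw [Nat.cast_sub hki]; ring)
    simp only [show k = i ↔ i - k = 0 by lia, ← h]
    refine Finset.sum_bij' (fun j _ => (i - j, j - k)) (fun p _ => k + p.2) ?_ ?_ ?_ ?_ ?_
    · intro j hj
      simp only [Finset.mem_Icc, Finset.HasAntidiagonal.mem_antidiagonal] at *
      lia
    · intro p hp
      simp only [Finset.mem_Icc, Finset.HasAntidiagonal.mem_antidiagonal] at *
      lia
    · intro j hj
      simp only [Finset.mem_Icc] at *
      lia
    · rintro ⟨p, q⟩ hp
      simp only [Finset.HasAntidiagonal.mem_antidiagonal, Prod.mk.injEq] at *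
      lia
    · intro j hj
      rfl
  rw [Finset.sum_congr rfl hF, Finset.sum_comm' (s' := fun k => Finset.Icc k i)
    (t' := Finset.Icc 1 i) (by intro j k; simp only [Finset.mem_Icc]; lia)]
  simp only [← Finset.mul_sum]
  rw [Finset.sum_congr rfl fun k hk => by rw [hinner k hk]]
  simp only [mul_ite, mul_one, mul_zero, Finset.sum_ite_eq', Finset.mem_Icc, hi, le_refl, and_self,
    if_true]
  rw [mul_left_comm, ← C_mul, ← mul_pow]
  simp
end

section
/- For all nonnegative integers i, j with j ≤ i, for any real λ and real x, one has ∑_{k=j}^{i} G_{i-k}^{(-λ)}(x) · G_{k-j}^{(λ)}(x) = δ_{ij} (Kronecker delta). -/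
/-- The ultraspherical (Gegenbauer) polynomial
`G_n^{(λ)}(x) = ∑_{k=0}^{⌊n/2⌋} (-1)^k (λ)_{n-k}/(k!(n-2k)!) (2x)^{n-2k}`. -/
noncomputable def gegenbauer (lam : ℝ) (n : ℕ) (x : ℝ) : ℝ :=
  ∑ k ∈ Finset.range (n / 2 + 1),
    (-1 : ℝ) ^ k * ((ascPochhammer ℝ (n - k)).eval lam /
      ((Nat.factorial k) * (Nat.factorial (n - 2 * k)))) * (2 * x) ^ (n - 2 * k)

/-- The formal generating function `∑ G_n^{(λ)}(x) t^n`. -/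
noncomputable def gegenbauerSeries (lam x : ℝ) : PowerSeries ℝ :=
  PowerSeries.mk fun n ↦ gegenbauer lam n x

theorem Ring.choose_neg_eq_eval_ascPochhammer (r : ℝ) (n : ℕ) :
    Ring.choose (-r) n = (-1) ^ n * ((ascPochhammer ℝ n).eval r / n.factorial) := by
  have h := Ring.factorial_nsmul_multichoose_eq_ascPochhammer r n
  rw [Polynomial.ascPochhammer_smeval_eq_eval, nsmul_eq_mul] at h
  rw [Ring.choose_neg', ← h, mul_div_cancel_left₀ _ (by positivity), Int.negOnePow_def,
    Units.smul_def]
  simp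

/-- The coefficients of the powers of `t (t + a)`. -/
theorem coeff_X_mul_X_add_C_pow (a : ℝ) (d n : ℕ) :
    PowerSeries.coeff n
        (((Polynomial.X * (Polynomial.X + Polynomial.C a) : Polynomial ℝ) : PowerSeries ℝ) ^ d) =
      if d ≤ n then a ^ (d - (n - d)) * (d.choose (n - d) : ℝ) else 0 := by
  rw [← Polynomial.coe_pow, Polynomial.coeff_coe, mul_pow, Polynomial.coeff_X_pow_mul',
    Polynomial.coeff_X_add_C_pow]

theorem hasSubst_X_mul_X_add_C (a : ℝ) :
    PowerSeries.HasSubst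
      ((Polynomial.X * (Polynomial.X + Polynomial.C a) : Polynomial ℝ) : PowerSeries ℝ) :=
  PowerSeries.HasSubst.of_constantCoeff_zero' (by simp)

/-- The generating function of the Gegenbauer polynomials is `(1 + (t ^ 2 - 2 x t)) ^ (-λ)`. -/
theorem gegenbauerSeries_eq_subst (lam x : ℝ) :
    gegenbauerSeries lam x =
      (PowerSeries.binomialSeries ℝ (-lam)).subst
        ((Polynomial.X * (Polynomial.X + Polynomial.C (-(2 * x))) : Polynomial ℝ) :
          PowerSeries ℝ) := by
  ext n
  rw [gegenbauerSeries, PowerSeries.coeff_mk, PowerSeries.coeff_subst' (hasSubst_X_mul_X_add_C _)]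
  simp only [PowerSeries.binomialSeries_coeff, coeff_X_mul_X_add_C_pow, smul_eq_mul, mul_one]
  rw [finsum_eq_sum_of_support_subset (s := Finset.range (n + 1)), ← Finset.sum_range_reflect,
    gegenbauer]
  · refine Finset.sum_subset_zero_on_sdiff (Finset.range_mono (by omega)) ?_ ?_
    · intro k hk
      simp only [Finset.mem_sdiff, Finset.mem_range] at hk
      rw [Nat.choose_eq_zero_of_lt (by omega)]
      simp
    · intro k hk
      rw [Finset.mem_range] at hk
      obtain ⟨m, rfl⟩ : ∃ m, n = 2 * k + m := ⟨n - 2 * k, by omega⟩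
      rw [show 2 * k + m + 1 - 1 - k = k + m by omega, show 2 * k + m - k = k + m by omega,
        show 2 * k + m - 2 * k = m by omega, if_pos (by omega),
        show 2 * k + m - (k + m) = k by omega, Nat.add_sub_cancel_left,
        Ring.choose_neg_eq_eval_ascPochhammer, Nat.cast_add_choose, neg_pow (2 * x), pow_add]
      have hm : ((-1 : ℝ) ^ m) * (-1) ^ m = 1 := by rw [← mul_pow]; simp
      field_simp
      linear_combination (-(ascPochhammer ℝ (k + m)).eval lam * (2 * x) ^ m) * hm
  · intro d hd
    by_contra h
    simp only [Finset.coe_range, Set.mem_Iio] at h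
    exact hd (mul_eq_zero_of_right _ (if_neg (by omega)))

theorem gegenbauerSeries_mul_neg (lam x : ℝ) :
    gegenbauerSeries lam x * gegenbauerSeries (-lam) x = 1 := by
  rw [gegenbauerSeries_eq_subst, gegenbauerSeries_eq_subst,
    ← PowerSeries.subst_mul (hasSubst_X_mul_X_add_C _), ← PowerSeries.binomialSeries_add,
    add_neg_cancel, PowerSeries.binomialSeries_zero,
    ← PowerSeries.coe_substAlgHom (hasSubst_X_mul_X_add_C _), map_one]

/-- Inversion formula for the ultraspherical polynomials:
`∑_{k=j}^{i} G_{i-k}^{(-λ)}(x) G_{k-j}^{(λ)}(x) = δ_{ij}`. -/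
theorem gegenbauer_inversion (lam x : ℝ) (i j : ℕ) (hij : j ≤ i) :
    ∑ k ∈ Finset.Icc j i, gegenbauer (-lam) (i - k) x * gegenbauer lam (k - j) x =
      if i = j then 1 else 0 := by
  obtain ⟨m, rfl⟩ := Nat.exists_eq_add_of_le hij
  have h := congrArg (PowerSeries.coeff m) (gegenbauerSeries_mul_neg lam x)
  rw [PowerSeries.coeff_mul, Finset.Nat.sum_antidiagonal_eq_sum_range_succ_mk,
    PowerSeries.coeff_one] at h
  simp only [gegenbauerSeries, PowerSeries.coeff_mk] at h
  rw [← Finset.Ico_succ_right_eq_Icc, Finset.sum_Ico_eq_sum_range]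
  have hm : j + m = j ↔ m = 0 := by omega
  simp only [hm, ← h]
  rw [Order.succ_eq_add_one, show j + m + 1 - j = m + 1 by omega]
  refine Finset.sum_congr rfl fun k _ ↦ ?_
  rw [Nat.add_sub_add_left, Nat.add_sub_cancel_left, mul_comm]
end

section
/- Fix a real x and a positive integer N. Define N×N matrices A = (a_{ij})_{i,j=1}^N and B = (b_{ij})_{i,j=1}^N by: a_{ij} = P_{i-j}(x) if j ≤ i and a_{ij} = 0 if j > i; and b_{ij} = 0 if i < j, b_{ij} = 1 if i = j, b_{ij} = -x if i = j+1, and b_{ij} = B_{i-j}(x) if i ≥ j+2, where B_n(x) = (1/n)(1-x) P_{n-1}^{(1,-1)}(x). Then A is lower triangular with determinant 1 and B is the inverse of A, i.e., B·A = I. -/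
/-- The Legendre polynomial `P_n(x) = ∑_{k=0}^{n} (n+k)!/((n-k)!(k!)^2) ((x-1)/2)^k`. -/
noncomputable def legendre (n : ℕ) (x : ℝ) : ℝ :=
  ∑ k ∈ Finset.range (n + 1),
    (Nat.factorial (n + k) : ℝ) /
      ((Nat.factorial (n - k)) * (Nat.factorial k) ^ 2) * ((x - 1) / 2) ^ k

/-- The Jacobi polynomial with arbitrary real parameters `α`, `β`:
`P_n^{(α,β)}(x) = ∑_{k=0}^{n} (n+α+β+1)_k/k! · (α+k+1)_{n-k}/(n-k)! · ((x-1)/2)^k`. -/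
noncomputable def jacobi (α β : ℝ) (n : ℕ) (x : ℝ) : ℝ :=
  ∑ k ∈ Finset.range (n + 1),
    ((ascPochhammer ℝ k).eval ((n : ℝ) + α + β + 1) / (Nat.factorial k)) *
      ((ascPochhammer ℝ (n - k)).eval (α + k + 1) / (Nat.factorial (n - k))) *
      ((x - 1) / 2) ^ k

/-- `B_n(x) = (1/n)(1-x) P_{n-1}^{(1,-1)}(x)`. -/
noncomputable def legendreB (n : ℕ) (x : ℝ) : ℝ :=
  (1 / (n : ℝ)) * (1 - x) * jacobi 1 (-1) (n - 1) x

open Finset PowerSeries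

/-- The coefficient of `((x - 1) / 2) ^ k` in the Legendre polynomial `P_n(x)`. -/
def legendreCoeff (n k : ℕ) : ℝ := (n.choose k : ℝ) * ((n + k).choose k : ℝ)

lemma legendreCoeff_zero_right (n : ℕ) : legendreCoeff n 0 = 1 := by
  simp [legendreCoeff]

lemma legendreCoeff_eq_zero {n k : ℕ} (h : n < k) : legendreCoeff n k = 0 := by
  simp [legendreCoeff, Nat.choose_eq_zero_of_lt h]

lemma legendreCoeff_eq_factorial {n k : ℕ} (h : k ≤ n) :
    legendreCoeff n k =
      (Nat.factorial (n + k) : ℝ) / ((Nat.factorial (n - k)) * (Nat.factorial k) ^ 2) := by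
  rw [legendreCoeff, Nat.cast_choose ℝ h, Nat.cast_choose ℝ (Nat.le_add_left k n),
    Nat.add_sub_cancel]
  have := Nat.factorial_ne_zero n
  have := Nat.factorial_ne_zero k
  have := Nat.factorial_ne_zero (n - k)
  field_simp

lemma legendreCoeff_succ_right (n k : ℕ) :
    ((k : ℝ) + 1) ^ 2 * legendreCoeff n (k + 1) =
      ((n : ℝ) + k + 1) * ((n : ℝ) - k) * legendreCoeff n k := by
  have h1 : (n.choose (k + 1) : ℝ) * (k + 1) = n.choose k * ((n : ℝ) - k) := by
    rcases le_or_gt k n with h | h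
    · have := congrArg (Nat.cast (R := ℝ)) (Nat.choose_succ_right_eq n k)
      push_cast [h] at this
      exact this
    · simp [Nat.choose_eq_zero_of_lt h, Nat.choose_eq_zero_of_lt (h.trans k.lt_succ_self)]
  have h2 : ((n : ℝ) + k + 1) * (n + k).choose k = (n + k + 1).choose (k + 1) * ((k : ℝ) + 1) := by
    exact_mod_cast Nat.add_one_mul_choose_eq (n + k) k
  simp only [legendreCoeff, ← add_assoc]
  linear_combination ((n + k + 1).choose (k + 1) : ℝ) * (k + 1) * h1 -
    (n.choose k : ℝ) * ((n : ℝ) - k) * h2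

lemma legendreCoeff_succ_left (n k : ℕ) :
    ((n : ℝ) + 1 - k) * legendreCoeff (n + 1) k = ((n : ℝ) + 1 + k) * legendreCoeff n k := by
  have h1 : (n.choose k : ℝ) * (n + 1) = (n + 1).choose k * ((n : ℝ) + 1 - k) := by
    rcases le_or_gt k (n + 1) with h | h
    · have := congrArg (Nat.cast (R := ℝ)) (Nat.choose_mul_succ_eq n k)
      push_cast [h] at this
      exact this
    · simp [Nat.choose_eq_zero_of_lt h, Nat.choose_eq_zero_of_lt (n.lt_succ_self.trans h)]
  have h2 : ((n + k).choose k : ℝ) * ((n : ℝ) + k + 1) =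
      (n + 1 + k).choose k * ((n : ℝ) + 1) := by
    have := Nat.choose_mul_succ_eq (n + k) k
    rw [show n + k + 1 - k = n + 1 by omega, show n + k + 1 = n + 1 + k by omega] at this
    have := congrArg (Nat.cast (R := ℝ)) this
    push_cast at this
    linear_combination this
  simp only [legendreCoeff]
  linear_combination -((n + 1 + k).choose k : ℝ) * h1 - (n.choose k : ℝ) * h2

lemma sq_mul_legendreCoeff_add_two (n k : ℕ) :
    ((k : ℝ) + 1) ^ 2 * legendreCoeff (n + 2) (k + 1) =
      ((n : ℝ) + k + 3) * (n + k + 2) * legendreCoeff (n + 1) k := by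
  have h1 := legendreCoeff_succ_right (n + 2) k
  have h2 := legendreCoeff_succ_left (n + 1) k
  push_cast at h1 h2
  linear_combination h1 + ((n : ℝ) + k + 3) * h2

lemma sq_mul_legendreCoeff (n k : ℕ) :
    ((k : ℝ) + 1) ^ 2 * legendreCoeff n (k + 1) =
      ((n : ℝ) - k) * (n + 1 - k) * legendreCoeff (n + 1) k := by
  linear_combination legendreCoeff_succ_right n k - ((n : ℝ) - k) * legendreCoeff_succ_left n k

lemma legendreCoeff_recurrence (n k : ℕ) :
    ((n : ℝ) + 2) * legendreCoeff (n + 2) (k + 1) =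
      (2 * n + 3) * (legendreCoeff (n + 1) (k + 1) + 2 * legendreCoeff (n + 1) k) -
        (n + 1) * legendreCoeff n (k + 1) := by
  have hk : ((k : ℝ) + 1) ^ 2 ≠ 0 := by positivity
  apply mul_left_cancel₀ hk
  have h := legendreCoeff_succ_right (n + 1) k
  push_cast at h
  linear_combination ((n : ℝ) + 2) * sq_mul_legendreCoeff_add_two n k - (2 * n + 3) * h +
    ((n : ℝ) + 1) * sq_mul_legendreCoeff n k

lemma legendreCoeff_sub (n k : ℕ) :
    legendreCoeff n (k + 1) - legendreCoeff (n + 2) (k + 1) =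
      (2 * n + 3) * (-2 * (legendreCoeff (n + 1) k / (k + 1))) := by
  have hk : ((k : ℝ) + 1) ≠ 0 := by positivity
  apply mul_left_cancel₀ (pow_ne_zero 2 hk)
  rw [mul_sub, sq_mul_legendreCoeff, sq_mul_legendreCoeff_add_two]
  field_simp
  ring

lemma legendre_eq_sum_legendreCoeff {n M : ℕ} (h : n < M) (x : ℝ) :
    legendre n x = ∑ k ∈ range M, legendreCoeff n k * ((x - 1) / 2) ^ k := by
  rw [legendre, ← sum_subset (range_subset_range.2 (Nat.succ_le_of_lt h))]
  · refine sum_congr rfl fun k hk => ?_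
    rw [legendreCoeff_eq_factorial (Nat.le_of_lt_succ (mem_range.1 hk))]
  · intro k _ hk
    rw [legendreCoeff_eq_zero (by rw [mem_range] at hk; omega), zero_mul]

lemma legendre_eq_one_add {n M : ℕ} (h : n ≤ M) (x : ℝ) :
    legendre n x = (∑ k ∈ range M, legendreCoeff n (k + 1) * ((x - 1) / 2) ^ (k + 1)) + 1 := by
  rw [legendre_eq_sum_legendreCoeff (Nat.lt_succ_of_le h), sum_range_succ']
  simp [legendreCoeff_zero_right]

lemma legendre_zero (x : ℝ) : legendre 0 x = 1 := by
  simp [legendre]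

lemma legendre_one (x : ℝ) : legendre 1 x = x := by
  simp [legendre, sum_range_succ]
  ring

/-- Bonnet's three-term recurrence. -/
lemma legendre_recurrence (n : ℕ) (x : ℝ) :
    ((n : ℝ) + 2) * legendre (n + 2) x =
      (2 * n + 3) * x * legendre (n + 1) x - (n + 1) * legendre n x := by
  have h : ((n : ℝ) + 2) *
        ∑ k ∈ range (n + 2), legendreCoeff (n + 2) (k + 1) * ((x - 1) / 2) ^ (k + 1) =
      (2 * n + 3) *
        ((∑ k ∈ range (n + 2), legendreCoeff (n + 1) (k + 1) * ((x - 1) / 2) ^ (k + 1)) +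
          (x - 1) * ∑ k ∈ range (n + 2), legendreCoeff (n + 1) k * ((x - 1) / 2) ^ k) -
      (n + 1) * ∑ k ∈ range (n + 2), legendreCoeff n (k + 1) * ((x - 1) / 2) ^ (k + 1) := by
    simp only [mul_sum, ← sum_add_distrib, ← sum_sub_distrib]
    refine sum_congr rfl fun k _ => ?_
    linear_combination ((x - 1) / 2) ^ (k + 1) * legendreCoeff_recurrence n k
  have h1 := legendre_eq_one_add (show n + 1 ≤ n + 2 by omega) x
  rw [← legendre_eq_sum_legendreCoeff (show n + 1 < n + 2 by omega) x] at h
  rw [legendre_eq_one_add le_rfl x, legendre_eq_one_add (show n ≤ n + 2 by omega) x]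
  linear_combination h - (2 * (n : ℝ) + 3) * h1

lemma legendreB_add_two (n : ℕ) (x : ℝ) :
    legendreB (n + 2) x =
      ∑ k ∈ range (n + 2), -2 * (legendreCoeff (n + 1) k / (k + 1)) * ((x - 1) / 2) ^ (k + 1) := by
  rw [legendreB, jacobi, mul_sum]
  refine sum_congr rfl fun k hk => ?_
  have hk : k ≤ n + 1 := Nat.le_of_lt_succ (mem_range.1 hk)
  have e1 : (((n + 2 - 1 : ℕ) : ℝ) + 1 + -1 + 1) = ((n + 1 + 1 : ℕ) : ℝ) := by
    rw [show n + 2 - 1 = n + 1 by omega]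
    push_cast
    ring
  have e2 : (1 : ℝ) + k + 1 = ((k + 1 + 1 : ℕ) : ℝ) := by
    push_cast
    ring
  have h1 := Nat.factorial_mul_ascFactorial (n + 1) k
  have h2 := Nat.factorial_mul_ascFactorial (k + 1) (n + 1 - k)
  rw [show k + 1 + (n + 1 - k) = n + 1 + 1 by omega, Nat.factorial_succ, Nat.factorial_succ] at h2
  replace h1 := congrArg (Nat.cast (R := ℝ)) h1
  replace h2 := congrArg (Nat.cast (R := ℝ)) h2
  push_cast at h1 h2
  rw [e1, e2, ← ascPochhammer_eval_cast, ← ascPochhammer_eval_cast,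
    ascPochhammer_nat_eq_ascFactorial, ascPochhammer_nat_eq_ascFactorial,
    show n + 2 - 1 = n + 1 by omega, legendreCoeff_eq_factorial hk, ← h1]
  have hn0 : ((n + 1).factorial : ℝ) ≠ 0 := by exact_mod_cast Nat.factorial_ne_zero _
  have hk0 : (k.factorial : ℝ) ≠ 0 := by exact_mod_cast Nat.factorial_ne_zero _
  have hnk0 : ((n + 1 - k).factorial : ℝ) ≠ 0 := by exact_mod_cast Nat.factorial_ne_zero _
  have hk1 : (k : ℝ) + 1 ≠ 0 := by positivity
  have hn2 : (n : ℝ) + 1 + 1 ≠ 0 := by positivity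
  have h3 : (((k + 1 + 1).ascFactorial (n + 1 - k) : ℕ) : ℝ) =
      ((n : ℝ) + 1 + 1) * (n + 1).factorial / (((k : ℝ) + 1) * k.factorial) := by
    rw [eq_div_iff (mul_ne_zero hk1 hk0), mul_comm, h2]
  rw [h3]
  have hn3 : (n : ℝ) + 2 ≠ 0 := by positivity
  push_cast
  field_simp
  ring

lemma legendreB_add_two_eq_legendre (n : ℕ) (x : ℝ) :
    legendreB (n + 2) x =
      legendre (n + 2) x - 2 * x * legendre (n + 1) x + legendre n x := by
  have h : (2 * (n : ℝ) + 3) * legendreB (n + 2) x = legendre n x - legendre (n + 2) x := by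
    rw [legendreB_add_two, legendre_eq_one_add (show n ≤ n + 2 by omega) x,
      legendre_eq_one_add (le_refl (n + 2)) x, add_sub_add_right_eq_sub,
      ← sum_sub_distrib, mul_sum]
    refine sum_congr rfl fun k _ => ?_
    linear_combination -((x - 1) / 2) ^ (k + 1) * legendreCoeff_sub n k
  have hn : (2 * (n : ℝ) + 3) ≠ 0 := by positivity
  apply mul_left_cancel₀ hn
  linear_combination h - 2 * legendre_recurrence n x

/-- The generating function `∑ P_n(x) t ^ n`. -/
noncomputable def legendreSeries (x : ℝ) : ℝ⟦X⟧ := mk fun n => legendre n x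

/-- The quadratic `1 - 2 x t + t ^ 2`. -/
noncomputable def legendreKernel (x : ℝ) : ℝ⟦X⟧ := 1 - C (2 * x) * X + X * X

lemma coeff_zero_legendreKernel_mul (x : ℝ) (f : ℝ⟦X⟧) :
    coeff 0 (legendreKernel x * f) = coeff 0 f := by
  simp [legendreKernel]

lemma coeff_one_legendreKernel_mul (x : ℝ) (f : ℝ⟦X⟧) :
    coeff 1 (legendreKernel x * f) = coeff 1 f - 2 * x * coeff 0 f := by
  simp only [legendreKernel, add_mul, sub_mul, one_mul, mul_assoc, map_add, map_sub]
  have h (g : ℝ⟦X⟧) : coeff 1 (X * g) = coeff 0 g := coeff_succ_X_mul 0 g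
  rw [coeff_C_mul, h, h, coeff_zero_X_mul]
  ring

lemma coeff_add_two_legendreKernel_mul (n : ℕ) (x : ℝ) (f : ℝ⟦X⟧) :
    coeff (n + 2) (legendreKernel x * f) =
      coeff (n + 2) f - 2 * x * coeff (n + 1) f + coeff n f := by
  simp only [legendreKernel, add_mul, sub_mul, one_mul, mul_assoc, map_add, map_sub]
  rw [coeff_C_mul, show n + 2 = n + 1 + 1 from rfl, coeff_succ_X_mul, coeff_succ_X_mul,
    coeff_succ_X_mul]
  ring

lemma legendreKernel_mul_derivative (x : ℝ) :
    legendreKernel x * derivative ℝ (legendreSeries x) =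
      (C x - X) * legendreSeries x := by
  ext n
  rcases n with _ | _ | n
  · rw [coeff_zero_legendreKernel_mul]
    simp [legendreSeries, coeff_derivative, legendre_zero, legendre_one]
  · have h := legendre_recurrence 0 x
    have hX (g : ℝ⟦X⟧) : coeff 1 (X * g) = coeff 0 g := coeff_succ_X_mul 0 g
    rw [zero_add, coeff_one_legendreKernel_mul, sub_mul, map_sub, coeff_C_mul, hX]
    simp only [legendreSeries, coeff_derivative, coeff_mk]
    norm_num [legendre_zero, legendre_one] at h ⊢
    linear_combination h
  · have h := legendre_recurrence (n + 1) x
    rw [coeff_add_two_legendreKernel_mul, sub_mul, map_sub, coeff_C_mul, coeff_succ_X_mul]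
    simp only [legendreSeries, coeff_derivative, coeff_mk]
    push_cast at h ⊢
    linear_combination h

lemma legendreKernel_mul_sq (x : ℝ) :
    legendreKernel x * legendreSeries x * legendreSeries x = 1 := by
  apply derivative.ext (R := ℝ)
  · have hK : derivative ℝ (legendreKernel x) = -2 * (C x - X) := by
      simp only [legendreKernel, map_add, map_sub, Derivation.leibniz, derivative_C,
        derivative_X, smul_eq_mul, Derivation.map_one_eq_zero]
      rw [map_mul, map_ofNat]
      ring
    simp only [Derivation.leibniz, smul_eq_mul, hK, Derivation.map_one_eq_zero]
    linear_combination 2 * legendreSeries x * legendreKernel_mul_derivative x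
  · simp [legendreKernel, legendreSeries, legendre_zero]

/-- The lower triangular `N × N` Toeplitz matrix of the coefficients of a power series. -/
noncomputable def toeplitz (N : ℕ) (f : ℝ⟦X⟧) : Matrix (Fin N) (Fin N) ℝ :=
  fun i j => if (j : ℕ) ≤ (i : ℕ) then coeff ((i : ℕ) - (j : ℕ)) f else 0

lemma toeplitz_one (N : ℕ) : toeplitz N 1 = 1 := by
  ext i j
  simp only [toeplitz, coeff_one, Matrix.one_apply, Fin.ext_iff]
  split_ifs <;> first | rfl | omega

lemma toeplitz_mul (N : ℕ) (f g : ℝ⟦X⟧) : toeplitz N f * toeplitz N g = toeplitz N (f * g) := by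
  ext i j
  let F : ℕ → ℝ := fun l =>
    (if l ≤ (i : ℕ) then coeff ((i : ℕ) - l) f else 0) *
      (if (j : ℕ) ≤ l then coeff (l - (j : ℕ)) g else 0)
  have hF : (toeplitz N f * toeplitz N g) i j = ∑ l ∈ range N, F l := by
    rw [Matrix.mul_apply, ← Fin.sum_univ_eq_sum_range]
    rfl
  have hs : ∑ l ∈ range N, F l = ∑ l ∈ Ico (j : ℕ) (i + 1), F l := by
    refine (sum_subset (fun l hl => ?_) fun l _ hl => ?_).symm
    · have := i.isLt
      simp only [mem_Ico, mem_range] at hl ⊢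
      omega
    · simp only [mem_Ico, not_and, not_lt] at hl
      by_cases hj : (j : ℕ) ≤ l
      · simp [F, show ¬ l ≤ (i : ℕ) by have := hl hj; omega]
      · simp [F, hj]
  rw [hF, hs, toeplitz]
  split_ifs with h
  · rw [sum_Ico_eq_sum_range, mul_comm f g, coeff_mul,
      Nat.sum_antidiagonal_eq_sum_range_succ (fun a b => coeff a g * coeff b f),
      show (i : ℕ) + 1 - j = ((i : ℕ) - j).succ by omega]
    refine sum_congr rfl fun m hm => ?_
    have hm := mem_range.1 hm
    simp [F, show (j : ℕ) + m ≤ i by omega, show (i : ℕ) - (j + m) = i - j - m by omega, mul_comm]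
  · rw [Ico_eq_empty (by omega), sum_empty]

lemma det_toeplitz (N : ℕ) (f : ℝ⟦X⟧) : (toeplitz N f).det = coeff 0 f ^ N := by
  rw [Matrix.det_of_isLowerTriangular]
  · simp [toeplitz]
  · intro i j hij
    have : (i : ℕ) < j := hij
    rw [toeplitz, if_neg this.not_ge]


/-- The lower triangular matrix `A` with entries `A_{ij} = P_{i-j}(x)` for `j ≤ i` has
determinant `1`, and its inverse is the matrix `B` with `B_{ii} = 1`, `B_{i,i-1} = -x`
and `B_{ij} = B_{i-j}(x)` for `i ≥ j+2`, where `B_n(x) = (1/n)(1-x) P_{n-1}^{(1,-1)}(x)`. -/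
theorem legendre_matrix_inversion (x : ℝ) (N : ℕ) (hN : 0 < N)
    (A B : Matrix (Fin N) (Fin N) ℝ)
    (hA : ∀ i j : Fin N,
      A i j = if (j : ℕ) ≤ (i : ℕ) then legendre ((i : ℕ) - (j : ℕ)) x else 0)
    (hB : ∀ i j : Fin N,
      B i j =
        if (i : ℕ) < (j : ℕ) then 0
        else if (i : ℕ) = (j : ℕ) then 1
        else if (i : ℕ) = (j : ℕ) + 1 then -x
        else legendreB ((i : ℕ) - (j : ℕ)) x) :
    (∀ i j : Fin N, (i : ℕ) < (j : ℕ) → A i j = 0) ∧ A.det = 1 ∧ B * A = 1 := by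
  have hA' : A = toeplitz N (legendreSeries x) := by
    ext i j
    simp [hA, toeplitz, legendreSeries]
  have hB' : B = toeplitz N (legendreKernel x * legendreSeries x) := by
    ext i j
    rw [hB, toeplitz]
    rcases lt_or_ge (i : ℕ) j with h | h
    · rw [if_pos h, if_neg h.not_ge]
    obtain ⟨n, hn⟩ := Nat.exists_eq_add_of_le h
    rw [if_neg h.not_gt, if_pos h, hn, Nat.add_sub_cancel_left]
    rcases n with _ | _ | n
    · rw [coeff_zero_legendreKernel_mul]
      simp [legendreSeries, legendre_zero]
    · rw [zero_add, coeff_one_legendreKernel_mul]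
      simp only [legendreSeries, coeff_mk, legendre_zero, legendre_one]
      rw [if_neg (by omega), if_pos trivial]
      ring
    · rw [coeff_add_two_legendreKernel_mul, if_neg (by omega), if_neg (by omega),
        legendreB_add_two_eq_legendre]
      simp [legendreSeries]
  refine ⟨fun i j h => by rw [hA, if_neg h.not_ge], ?_, ?_⟩
  · rw [hA', det_toeplitz]
    simp [legendreSeries, legendre_zero]
  · rw [hA', hB', toeplitz_mul, legendreKernel_mul_sq, toeplitz_one]
end

section
/- For every integer n ≥ 2 and all real x, one has (-2/(n-1)) · P_n^{(-1,-1)}(x) = (1/n)(1-x) · P_{n-1}^{(1,-1)}(x). -/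
theorem ascPochhammer_eval_succ_left (m : ℕ) (a : ℝ) :
    (ascPochhammer ℝ (m + 1)).eval a = a * (ascPochhammer ℝ m).eval (a + 1) := by
  simp [ascPochhammer_succ_left, Polynomial.eval_comp]

theorem ascPochhammer_eval_mul_add (m : ℕ) (a : ℝ) :
    (ascPochhammer ℝ m).eval a * (a + m) = a * (ascPochhammer ℝ m).eval (a + 1) := by
  rw [← ascPochhammer_succ_eval, ascPochhammer_eval_succ_left]

/-- For `n ≥ 2`: `(-2/(n-1)) P_n^{(-1,-1)}(x) = (1/n)(1-x) P_{n-1}^{(1,-1)}(x)`. -/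
theorem jacobi_minus_one_identity (n : ℕ) (hn : 2 ≤ n) (x : ℝ) :
    (-2 / ((n : ℝ) - 1)) * jacobi (-1) (-1) n x =
      (1 / (n : ℝ)) * (1 - x) * jacobi 1 (-1) (n - 1) x := by
  obtain ⟨m, rfl⟩ : ∃ m, n = m + 1 := ⟨n - 1, by omega⟩
  have hm : (m : ℝ) ≠ 0 := by
    have : m ≠ 0 := by omega
    exact_mod_cast this
  have hm1 : (m : ℝ) + 1 ≠ 0 := by positivity
  simp only [jacobi, Nat.add_sub_cancel]
  rw [Finset.sum_range_succ', mul_add, Finset.mul_sum, Finset.mul_sum]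
  have h0 : (ascPochhammer ℝ (m + 1 - 0)).eval (-1 + ((0 : ℕ) : ℝ) + 1) = 0 := by
    simp
  rw [h0, zero_div, mul_zero, zero_mul, mul_zero, add_zero]
  refine Finset.sum_congr rfl fun j hj => ?_
  have hjm : j ≤ m := by simpa [Nat.lt_succ_iff] using hj
  have key := ascPochhammer_eval_mul_add (m - j) ((j : ℝ) + 1)
  rw [Nat.cast_sub hjm, show (j : ℝ) + 1 + (m - j) = m + 1 by ring,
    ← eq_div_iff hm1] at key
  have hj1 : (j : ℝ) + 1 ≠ 0 := by positivity
  have hf : (j.factorial : ℝ) ≠ 0 := by positivity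
  have hg : ((m - j).factorial : ℝ) ≠ 0 := by positivity
  rw [Nat.add_sub_add_right, Nat.factorial_succ]
  push_cast
  rw [show (m : ℝ) + 1 + -1 + -1 + 1 = m by ring, show (-1 : ℝ) + (j + 1) + 1 = j + 1 by ring,
    show (m : ℝ) + 1 + -1 + 1 = m + 1 by ring, show (1 : ℝ) + j + 1 = j + 1 + 1 by ring,
    ascPochhammer_eval_succ_left, key, add_sub_cancel_right, pow_succ]
  field_simp
  ring
end

section
/- For every integer n ≥ 2 and every real x, the limit as λ → -1/2 of G_n^{(λ)}(x) equals (-2/(n-1)) · P_n^{(-1,-1)}(x). Moreover G_1^{(λ)}(x) = 2λx tends to -x as λ → -1/2, and G_0^{(λ)}(x) = 1. -/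
open Polynomial in
/-- The operator `y ↦ (1 - X²) y'' + n (n - 1) y` on real polynomials. -/
noncomputable def gegenbauerOperator (n : ℕ) (p : ℝ[X]) : ℝ[X] :=
  (1 - X ^ 2) * derivative (derivative p) + C ((n : ℝ) * (n - 1)) * p

namespace gegenbauerOperator

open Polynomial

theorem map_add (n : ℕ) (p q : ℝ[X]) :
    gegenbauerOperator n (p + q) = gegenbauerOperator n p + gegenbauerOperator n q := by
  simp only [gegenbauerOperator, derivative_add]
  ring

theorem map_sub (n : ℕ) (p q : ℝ[X]) :
    gegenbauerOperator n (p - q) = gegenbauerOperator n p - gegenbauerOperator n q := by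
  simp only [gegenbauerOperator, derivative_sub]
  ring

theorem map_C_mul (n : ℕ) (a : ℝ) (p : ℝ[X]) :
    gegenbauerOperator n (C a * p) = C a * gegenbauerOperator n p := by
  simp only [gegenbauerOperator, derivative_C_mul]
  ring

theorem X_pow (n m : ℕ) :
    gegenbauerOperator n (X ^ m) = C ((m : ℝ) * (m - 1)) * X ^ (m - 2) +
      C ((n : ℝ) * (n - 1) - m * (m - 1)) * X ^ m := by
  rcases m with _ | _ | m
  · simp [gegenbauerOperator]
  · simp [gegenbauerOperator]
  · simp [gegenbauerOperator]
    ring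

theorem X_sub_one_pow (n m : ℕ) :
    gegenbauerOperator n ((X - C 1) ^ m) = C ((n : ℝ) * (n - 1) - m * (m - 1)) * (X - C 1) ^ m -
      C (2 * (m : ℝ) * (m - 1)) * (X - C 1) ^ (m - 1) := by
  rcases m with _ | _ | m
  · simp [gegenbauerOperator]
  · simp [gegenbauerOperator]
  · have hC : (C 2 : ℝ[X]) = 2 := rfl
    simp [gegenbauerOperator, derivative_pow, hC]
    ring

/-- A polynomial of degree less than `n` annihilated by the operator vanishes. -/
theorem eq_zero_of_coeff {n : ℕ} (hn : 2 ≤ n) {p : ℝ[X]} (hp : gegenbauerOperator n p = 0)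
    (hc : ∀ m, n ≤ m → p.coeff m = 0) : p = 0 := by
  by_contra h0
  have hlc : p.coeff p.natDegree ≠ 0 := by simpa using h0
  have hlt : p.natDegree < n := by
    by_contra! h
    exact hlc (hc _ h)
  have htop : p.coeff (p.natDegree + 2) = 0 := coeff_eq_zero_of_natDegree_lt (by omega)
  generalize p.natDegree = m at *
  have h := congrArg (fun q => q.coeff m) hp
  have key : ((n : ℝ) * (n - 1) - m * (m - 1)) * p.coeff m = 0 := by
    rcases m with _ | _ | m
    · simpa [gegenbauerOperator, sub_mul, coeff_X_pow_mul', coeff_derivative, htop, mul_assoc]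
        using h
    · simpa [gegenbauerOperator, sub_mul, coeff_X_pow_mul', coeff_derivative, htop, mul_assoc]
        using h
    · simp [gegenbauerOperator, sub_mul, coeff_X_pow_mul', coeff_derivative, htop, mul_assoc] at h
      push_cast
      linear_combination h
  have h1 : (m : ℝ) + 1 ≤ n := by exact_mod_cast hlt
  have h2 : (2 : ℝ) ≤ n := by exact_mod_cast hn
  have h3 : (0 : ℝ) ≤ m := Nat.cast_nonneg m
  exact hlc ((mul_eq_zero.mp key).resolve_left (by nlinarith))

end gegenbauerOperator

/-- The coefficient of `x ^ (n - 2k)` in the ultraspherical polynomial. -/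
noncomputable def gegenbauerCoeff (lam : ℝ) (n k : ℕ) : ℝ :=
  (-1 : ℝ) ^ k * ((ascPochhammer ℝ (n - k)).eval lam /
      ((Nat.factorial k) * (Nat.factorial (n - 2 * k)))) * 2 ^ (n - 2 * k)

theorem gegenbauerCoeff_succ (lam : ℝ) {n k : ℕ} (h : 2 * (k + 1) ≤ n) :
    gegenbauerCoeff lam n (k + 1) * (4 * (k + 1) * (lam + n - k - 1)) =
      -(gegenbauerCoeff lam n k * ((n - 2 * k : ℕ) * ((n - 2 * k : ℕ) - 1))) := by
  obtain ⟨j, rfl⟩ := Nat.exists_eq_add_of_le h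
  have e1 : 2 * (k + 1) + j - (k + 1) = k + 1 + j := by omega
  have e2 : 2 * (k + 1) + j - 2 * (k + 1) = j := by omega
  have e3 : 2 * (k + 1) + j - k = k + 1 + j + 1 := by omega
  have e4 : 2 * (k + 1) + j - 2 * k = j + 2 := by omega
  have hk : ((Nat.factorial k : ℕ) : ℝ) ≠ 0 := by positivity
  have hj : ((Nat.factorial j : ℕ) : ℝ) ≠ 0 := by positivity
  simp only [gegenbauerCoeff, e1, e2, e3, e4, ascPochhammer_succ_eval, Nat.factorial_succ]
  push_cast
  field_simp
  ring

/-- The coefficient of `(x - 1) ^ k` in the Jacobi polynomial with parameters `-1`, `-1`. -/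
noncomputable def jacobiCoeff (n k : ℕ) : ℝ :=
  ((ascPochhammer ℝ k).eval ((n : ℝ) + -1 + -1 + 1) / (Nat.factorial k)) *
      ((ascPochhammer ℝ (n - k)).eval (-1 + (k : ℝ) + 1) / (Nat.factorial (n - k))) * (1 / 2) ^ k

theorem jacobiCoeff_succ {n k : ℕ} (h : k + 1 ≤ n) :
    jacobiCoeff n (k + 1) * (2 * ((k + 1 : ℕ) : ℝ) * ((k + 1 : ℕ) - 1)) =
      jacobiCoeff n k * ((n : ℝ) * (n - 1) - k * (k - 1)) := by
  obtain ⟨j, rfl⟩ := Nat.exists_eq_add_of_le h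
  have e1 : k + 1 + j - (k + 1) = j := by omega
  have e2 : k + 1 + j - k = j + 1 := by omega
  have hk : ((Nat.factorial k : ℕ) : ℝ) ≠ 0 := by positivity
  have hj : ((Nat.factorial j : ℕ) : ℝ) ≠ 0 := by positivity
  have hs : (ascPochhammer ℝ (j + 1)).eval (-1 + (k : ℝ) + 1) =
      k * (ascPochhammer ℝ j).eval ((k : ℝ) + 1) := by
    simp [ascPochhammer_succ_left]
  have e3 : (-1 : ℝ) + (k + 1) + 1 = k + 1 := by ring
  simp only [jacobiCoeff, e1, e2, hs, Nat.factorial_succ]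
  rw [ascPochhammer_succ_eval]
  push_cast
  rw [e3]
  field_simp
  ring

theorem four_pow_mul_ascPochhammer_neg_half {n : ℕ} (hn : 2 ≤ n) :
    4 ^ n * ((n : ℝ) - 1) * (ascPochhammer ℝ n).eval (-(1 / 2)) =
      -2 * (ascPochhammer ℝ n).eval ((n : ℝ) - 1) := by
  induction n, hn using Nat.le_induction with
  | base => norm_num [ascPochhammer_succ_eval]
  | succ n hn ih =>
    have h2 : (2 : ℝ) ≤ n := by exact_mod_cast hn
    have hne : (n : ℝ) - 1 ≠ 0 := by linarith
    have hs : ((n : ℝ) - 1) * (ascPochhammer ℝ (n + 1)).eval (n : ℝ) =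
        (ascPochhammer ℝ n).eval ((n : ℝ) - 1) * (2 * n - 1) * (2 * n) := by
      have h := congrArg (Polynomial.eval ((n : ℝ) - 1)) (ascPochhammer_succ_left ℝ (n + 1))
      rw [ascPochhammer_succ_eval, ascPochhammer_succ_eval] at h
      simp only [Polynomial.eval_mul, Polynomial.eval_X, Polynomial.eval_comp,
        Polynomial.eval_add, Polynomial.eval_one, sub_add_cancel] at h
      rw [← h]
      push_cast
      ring
    apply mul_left_cancel₀ hne
    push_cast
    rw [add_sub_cancel_right, ascPochhammer_succ_eval (S := ℝ) n (-(1 / 2))]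
    linear_combination (4 * n * (n - 1 / 2)) * ih + 2 * hs

open Polynomial in
/-- The ultraspherical polynomial with parameter `-1/2` as a formal polynomial. -/
noncomputable def gegenbauerNegHalf (n : ℕ) : ℝ[X] :=
  ∑ k ∈ Finset.range (n / 2 + 1), C (gegenbauerCoeff (-(1 / 2)) n k) * X ^ (n - 2 * k)

open Polynomial in
/-- The Jacobi polynomial with parameters `-1`, `-1` as a formal polynomial. -/
noncomputable def jacobiNegOne (n : ℕ) : ℝ[X] :=
  ∑ k ∈ Finset.range (n + 1), C (jacobiCoeff n k) * (X - C 1) ^ k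

theorem eval_gegenbauerNegHalf (n : ℕ) (x : ℝ) :
    (gegenbauerNegHalf n).eval x = gegenbauer (-(1 / 2)) n x := by
  simp [gegenbauerNegHalf, gegenbauer, gegenbauerCoeff, Polynomial.eval_finsetSum, mul_pow,
    mul_assoc]

theorem eval_jacobiNegOne (n : ℕ) (x : ℝ) :
    (jacobiNegOne n).eval x = jacobi (-1) (-1) n x := by
  simp only [jacobiNegOne, jacobi, jacobiCoeff, Polynomial.eval_finsetSum]
  refine Finset.sum_congr rfl fun k _ => ?_
  simp [div_pow]
  ring

open Polynomial in
theorem gegenbauerOperator_gegenbauerNegHalf (n : ℕ) :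
    gegenbauerOperator n (gegenbauerNegHalf n) = 0 := by
  have partialSum : ∀ N, 2 * N ≤ n → gegenbauerOperator n (∑ k ∈ Finset.range (N + 1),
      C (gegenbauerCoeff (-(1 / 2)) n k) * X ^ (n - 2 * k)) =
      C (gegenbauerCoeff (-(1 / 2)) n N * ((n - 2 * N : ℕ) * ((n - 2 * N : ℕ) - 1))) *
        X ^ (n - 2 * N - 2) := by
    intro N
    induction N with
    | zero =>
      intro _
      simp [gegenbauerOperator.map_C_mul, gegenbauerOperator.X_pow, mul_assoc]
    | succ N ih =>
      intro hN
      rw [Finset.sum_range_succ, gegenbauerOperator.map_add, ih (by omega),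
        gegenbauerOperator.map_C_mul, gegenbauerOperator.X_pow,
        show n - 2 * N - 2 = n - 2 * (N + 1) by omega]
      have h := gegenbauerCoeff_succ (-(1 / 2)) hN
      have h' : gegenbauerCoeff (-(1 / 2)) n N * ((n - 2 * N : ℕ) * ((n - 2 * N : ℕ) - 1)) +
          gegenbauerCoeff (-(1 / 2)) n (N + 1) * ((n : ℝ) * (n - 1) -
            (n - 2 * (N + 1) : ℕ) * ((n - 2 * (N + 1) : ℕ) - 1)) = 0 := by
        rw [Nat.cast_sub hN]
        push_cast
        linear_combination h
      have h'' := congrArg (C : ℝ →+* ℝ[X]) h'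
      rw [C_add, C_mul (a := gegenbauerCoeff (-(1 / 2)) n (N + 1)), C_0] at h''
      rw [C_mul (a := gegenbauerCoeff (-(1 / 2)) n (N + 1))]
      linear_combination X ^ (n - 2 * (N + 1)) * h''
  rw [gegenbauerNegHalf, partialSum _ (by omega)]
  have h : n - 2 * (n / 2) = 0 ∨ n - 2 * (n / 2) = 1 := by omega
  rcases h with h | h <;> simp [h]

open Polynomial in
theorem gegenbauerOperator_jacobiNegOne (n : ℕ) :
    gegenbauerOperator n (jacobiNegOne n) = 0 := by
  have partialSum : ∀ N, N ≤ n → gegenbauerOperator n (∑ k ∈ Finset.range (N + 1),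
      C (jacobiCoeff n k) * (X - C 1) ^ k) =
      C (jacobiCoeff n N * ((n : ℝ) * (n - 1) - N * (N - 1))) * (X - C 1) ^ N := by
    intro N
    induction N with
    | zero =>
      intro _
      rw [Finset.sum_range_one, gegenbauerOperator.map_C_mul, gegenbauerOperator.X_sub_one_pow]
      simp
    | succ N ih =>
      intro hN
      rw [Finset.sum_range_succ, gegenbauerOperator.map_add, ih (by omega),
        gegenbauerOperator.map_C_mul, gegenbauerOperator.X_sub_one_pow, Nat.add_sub_cancel,
        ← jacobiCoeff_succ hN]
      simp only [C_mul (a := jacobiCoeff n (N + 1))]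
      ring
  rw [jacobiNegOne, partialSum n le_rfl]
  simp

theorem coeff_gegenbauerNegHalf {n m : ℕ} (h : n ≤ m) :
    (gegenbauerNegHalf n).coeff m = if m = n then gegenbauerCoeff (-(1 / 2)) n 0 else 0 := by
  simp only [gegenbauerNegHalf, Polynomial.finsetSum_coeff, Polynomial.coeff_C_mul,
    Polynomial.coeff_X_pow]
  rw [Finset.sum_eq_single 0]
  · simp
  · intro k hk hk0
    rw [Finset.mem_range] at hk
    rw [if_neg (by omega), mul_zero]
  · simp

theorem coeff_jacobiNegOne {n m : ℕ} (h : n ≤ m) :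
    (jacobiNegOne n).coeff m = if m = n then jacobiCoeff n n else 0 := by
  have hlt : ∀ k < m, ((Polynomial.X - Polynomial.C (1 : ℝ)) ^ k).coeff m = 0 := fun k hk =>
    Polynomial.coeff_eq_zero_of_natDegree_lt
      (by rwa [Polynomial.natDegree_pow, Polynomial.natDegree_X_sub_C, mul_one])
  simp only [jacobiNegOne, Polynomial.finsetSum_coeff, Polynomial.coeff_C_mul]
  rw [Finset.sum_eq_single n]
  · split_ifs with hm
    · have hlead := ((Polynomial.monic_X_sub_C (1 : ℝ)).pow n).coeff_natDegree
      rw [Polynomial.natDegree_pow, Polynomial.natDegree_X_sub_C, mul_one] at hlead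
      rw [hm, hlead, mul_one]
    · rw [hlt n (by omega), mul_zero]
  · intro k hk hkn
    rw [Finset.mem_range] at hk
    rw [hlt k (by omega), mul_zero]
  · simp

theorem gegenbauerCoeff_neg_half_zero {n : ℕ} (hn : 2 ≤ n) :
    gegenbauerCoeff (-(1 / 2)) n 0 = -2 / ((n : ℝ) - 1) * jacobiCoeff n n := by
  have h2 : (2 : ℝ) ≤ n := by exact_mod_cast hn
  have hne : (n : ℝ) - 1 ≠ 0 := by linarith
  have hf : ((Nat.factorial n : ℕ) : ℝ) ≠ 0 := by positivity
  have h := four_pow_mul_ascPochhammer_neg_half hn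
  have h4 : (4 : ℝ) ^ n = 2 ^ n * 2 ^ n := by rw [← mul_pow]; norm_num
  rw [h4] at h
  simp only [gegenbauerCoeff, jacobiCoeff, one_div_pow]
  rw [show (n : ℝ) + -1 + -1 + 1 = n - 1 by ring]
  simp only [pow_zero, one_mul, Nat.sub_zero, mul_zero, Nat.factorial_zero, Nat.cast_one,
    Nat.sub_self, ascPochhammer_zero, Polynomial.eval_one, div_one, mul_one]
  generalize (ascPochhammer ℝ n).eval (-(1 / 2)) = a at *
  field_simp
  linear_combination h

theorem gegenbauerNegHalf_eq {n : ℕ} (hn : 2 ≤ n) :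
    gegenbauerNegHalf n = Polynomial.C (-2 / ((n : ℝ) - 1)) * jacobiNegOne n := by
  rw [← sub_eq_zero]
  apply gegenbauerOperator.eq_zero_of_coeff hn
  · rw [gegenbauerOperator.map_sub, gegenbauerOperator.map_C_mul,
      gegenbauerOperator_gegenbauerNegHalf, gegenbauerOperator_jacobiNegOne, mul_zero, sub_zero]
  · intro m hm
    rw [Polynomial.coeff_sub, Polynomial.coeff_C_mul, coeff_gegenbauerNegHalf hm,
      coeff_jacobiNegOne hm]
    split_ifs
    · rw [gegenbauerCoeff_neg_half_zero hn, sub_self]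
    · simp

theorem continuous_gegenbauer (n : ℕ) (x : ℝ) : Continuous fun lam => gegenbauer lam n x := by
  unfold gegenbauer
  fun_prop

theorem gegenbauer_one (lam x : ℝ) : gegenbauer lam 1 x = 2 * lam * x := by
  simp [gegenbauer]
  ring

/-- For `n ≥ 2`, `G_n^{(λ)}(x) → (-2/(n-1)) P_n^{(-1,-1)}(x)` as `λ → -1/2`; moreover
`G_1^{(λ)}(x) = 2λx → -x` as `λ → -1/2`, and `G_0^{(λ)}(x) = 1`. -/
theorem gegenbauer_limit_at_minus_half (x : ℝ) :
    (∀ n : ℕ, 2 ≤ n →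
      Filter.Tendsto (fun lam : ℝ => gegenbauer lam n x) (nhds (-(1 / 2)))
        (nhds ((-2 / ((n : ℝ) - 1)) * jacobi (-1) (-1) n x))) ∧
    (∀ lam : ℝ, gegenbauer lam 1 x = 2 * lam * x) ∧
    Filter.Tendsto (fun lam : ℝ => gegenbauer lam 1 x) (nhds (-(1 / 2))) (nhds (-x)) ∧
    (∀ lam : ℝ, gegenbauer lam 0 x = 1) := by
  refine ⟨fun n hn => ?_, fun lam => gegenbauer_one lam x, ?_, fun lam => by simp [gegenbauer]⟩
  · rw [← eval_jacobiNegOne, ← Polynomial.eval_C_mul, ← gegenbauerNegHalf_eq hn,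
      eval_gegenbauerNegHalf]
    exact (continuous_gegenbauer n x).tendsto _
  · have h := (continuous_gegenbauer 1 x).tendsto (-(1 / 2))
    rwa [gegenbauer_one, show 2 * -(1 / 2) * x = -x by ring] at h
end

section
/- Fix a real x and a positive integer N. Define N×N matrices A = (a_{ij})_{i,j=1}^N and B = (b_{ij})_{i,j=1}^N by: a_{ij} = T_{i-j}(x) if j ≤ i and a_{ij} = 0 if j > i; and b_{ij} = 0 if i < j, b_{ij} = 1 if i = j, b_{ij} = -x if i = j+1, and b_{ij} = x^{i-j-2}(1 - x²) if i ≥ j+2. Then A is lower triangular with determinant 1 and B is the inverse of A, i.e., B·A = I. -/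
open Finset in
/-- The convolution of the powers of `x` with the Chebyshev polynomials at `x`. -/
theorem one_sub_sq_mul_sum_pow_mul_chebyshevT {R : Type*} [CommRing R] (x : R) (n : ℕ) :
    (1 - x ^ 2) * ∑ k ∈ range (n + 1), x ^ (n - k) * (Polynomial.Chebyshev.T R (k : ℤ)).eval x =
      x * (Polynomial.Chebyshev.T R ((n + 1 : ℕ) : ℤ)).eval x -
        (Polynomial.Chebyshev.T R ((n + 2 : ℕ) : ℤ)).eval x := by
  induction n with
  | zero => simp [Polynomial.Chebyshev.T_two]; ring
  | succ n ih =>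
    have hsum : ∑ k ∈ range (n + 1), x ^ (n + 1 - k) *
          (Polynomial.Chebyshev.T R (k : ℤ)).eval x =
        x * ∑ k ∈ range (n + 1), x ^ (n - k) * (Polynomial.Chebyshev.T R (k : ℤ)).eval x := by
      rw [mul_sum]
      refine sum_congr rfl fun k hk => ?_
      rw [Nat.sub_add_comm (mem_range_succ_iff.mp hk), pow_succ]
      ring
    have hrec := congrArg (Polynomial.eval x)
      (Polynomial.Chebyshev.T_add_two R ((n + 1 : ℕ) : ℤ))
    simp only [Polynomial.eval_sub, Polynomial.eval_mul, Polynomial.eval_ofNat,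
      Polynomial.eval_X] at hrec
    rw [sum_range_succ, hsum, Nat.sub_self]
    push_cast at ih hrec ⊢
    simp only [add_assoc] at ih hrec ⊢
    norm_num at ih hrec ⊢
    linear_combination x * ih + hrec

open Finset in
/-- An entry of the product of two lower triangular Toeplitz matrices is a convolution. -/
theorem Matrix.mul_apply_of_lowerTriangular_toeplitz {R : Type*} [NonUnitalNonAssocSemiring R]
    {N : ℕ} {A B : Matrix (Fin N) (Fin N) R} {a b : ℕ → R}
    (hA : ∀ i j : Fin N, A i j = if (j : ℕ) ≤ i then a (i - j) else 0)
    (hB : ∀ i j : Fin N, B i j = if (j : ℕ) ≤ i then b (i - j) else 0) (i j : Fin N) :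
    (B * A) i j =
      if (j : ℕ) ≤ i then ∑ k ∈ range ((i : ℕ) - j + 1), b ((i : ℕ) - j - k) * a k else 0 := by
  simp only [Matrix.mul_apply, hA, hB]
  rw [Fin.sum_univ_eq_sum_range (fun k => (if k ≤ (i : ℕ) then b (i - k) else 0) *
    (if (j : ℕ) ≤ k then a (k - j) else 0))]
  split_ifs with hji
  · have hsub : Ico (j : ℕ) (i + 1) ⊆ range N := fun k hk => by
      simp only [mem_Ico, mem_range] at hk ⊢
      omega
    rw [← sum_subset hsub, sum_Ico_eq_sum_range, Nat.sub_add_comm hji]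
    · refine sum_congr rfl fun k hk => ?_
      rw [mem_range] at hk
      rw [if_pos (by omega), if_pos (by omega), Nat.add_sub_cancel_left, Nat.sub_add_eq]
    · intro k _ hk
      rw [mem_Ico, not_and_or] at hk
      rcases hk with hk | hk
      · rw [if_neg hk, mul_zero]
      · rw [if_neg (by omega), zero_mul]
  · refine sum_eq_zero fun k _ => ?_
    by_cases hk : k ≤ (i : ℕ)
    · rw [if_neg (show ¬ (j : ℕ) ≤ k by omega), mul_zero]
    · rw [if_neg hk, zero_mul]


/-- The lower triangular matrix `A` with entries `A_{ij} = T_{i-j}(x)` for `j ≤ i`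
(Chebyshev polynomials of the first kind) has determinant `1`, and its inverse is the
matrix `B` with `B_{ii} = 1`, `B_{i,i-1} = -x` and `B_{ij} = x^{i-j-2}(1-x²)` for `i ≥ j+2`. -/
theorem chebyshevT_matrix_inversion (x : ℝ) (N : ℕ) (hN : 0 < N)
    (A B : Matrix (Fin N) (Fin N) ℝ)
    (hA : ∀ i j : Fin N,
      A i j = if (j : ℕ) ≤ (i : ℕ)
        then (Polynomial.Chebyshev.T ℝ (((i : ℕ) - (j : ℕ) : ℕ) : ℤ)).eval x else 0)
    (hB : ∀ i j : Fin N,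
      B i j =
        if (i : ℕ) < (j : ℕ) then 0
        else if (i : ℕ) = (j : ℕ) then 1
        else if (i : ℕ) = (j : ℕ) + 1 then -x
        else x ^ ((i : ℕ) - (j : ℕ) - 2) * (1 - x ^ 2)) :
    (∀ i j : Fin N, (i : ℕ) < (j : ℕ) → A i j = 0) ∧ A.det = 1 ∧ B * A = 1 := by
  have hlower : ∀ i j : Fin N, (i : ℕ) < (j : ℕ) → A i j = 0 := fun i j hij => by
    rw [hA, if_neg hij.not_ge]
  refine ⟨hlower, ?_, ?_⟩
  · rw [Matrix.det_of_isLowerTriangular A fun i j hij => hlower i j hij]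
    exact Finset.prod_eq_one fun i _ => by simp [hA]
  · let b : ℕ → ℝ := fun n =>
      if n = 0 then 1 else if n = 1 then -x else x ^ (n - 2) * (1 - x ^ 2)
    have hB' : ∀ i j : Fin N, B i j = if (j : ℕ) ≤ i then b (i - j) else 0 := by
      intro i j
      rw [hB]
      simp only [b]
      split_ifs <;> first | rfl | omega
    ext i j
    rw [Matrix.mul_apply_of_lowerTriangular_toeplitz
      (a := fun n : ℕ => (Polynomial.Chebyshev.T ℝ (n : ℤ)).eval x) (b := b) hA hB', Matrix.one_apply]
    by_cases hji : (j : ℕ) ≤ i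
    · rw [if_pos hji]
      obtain ⟨n, hn⟩ := Nat.exists_eq_add_of_le hji
      simp only [b, hn, Nat.add_sub_cancel_left, Fin.ext_iff, Nat.add_eq_left]
      match n with
      | 0 => simp
      | 1 => simp [Finset.sum_range_succ]
      | n + 2 =>
        have hconv := one_sub_sq_mul_sum_pow_mul_chebyshevT x n
        rw [Finset.mul_sum] at hconv
        rw [Finset.sum_range_succ, Finset.sum_range_succ, Finset.sum_congr rfl
          (g := fun k : ℕ => (1 - x ^ 2) *
            (x ^ (n - k) * (Polynomial.Chebyshev.T ℝ (k : ℤ)).eval x)), hconv]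
        · simp
          ring
        · intro k hk
          rw [Finset.mem_range] at hk
          rw [if_neg (by omega), if_neg (by omega), show n + 2 - k - 2 = n - k by omega]
          ring
    · rw [if_neg hji, if_neg (by rintro rfl; exact hji le_rfl)]
end

section
/- For all nonnegative integers i, j with j ≤ i, for any real λ, real x and real φ, one has ∑_{k=j}^{i} P_{i-k}^{(-λ)}(-x;φ) · P_{k-j}^{(λ)}(x;φ) = δ_{ij}; equivalently, ∑_{k=j}^{i} P_{i-k}^{(-λ)}(x;-φ) · P_{k-j}^{(λ)}(x;φ) = δ_{ij} (Kronecker delta). -/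
open Complex

/-- The Meixner–Pollaczek polynomial
`P_n^{(λ)}(x;φ) = ∑_{k=0}^{n} (λ-ix)_k e^{ikφ}/k! · (λ+ix)_{n-k} e^{-i(n-k)φ}/(n-k)!`. -/
noncomputable def meixnerPollaczek (lam x φ : ℝ) (n : ℕ) : ℂ :=
  ∑ k ∈ Finset.range (n + 1),
    ((ascPochhammer ℂ k).eval ((lam : ℂ) - Complex.I * x) * Complex.exp (Complex.I * k * φ) /
        (Nat.factorial k)) *
      ((ascPochhammer ℂ (n - k)).eval ((lam : ℂ) + Complex.I * x) *
        Complex.exp (-Complex.I * ((n : ℂ) - k) * φ) / (Nat.factorial (n - k)))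

open PowerSeries in
/-- The coefficient of `t ^ n` in `(1 - c * t) ^ (-a)` is `(a)_n * c ^ n / n!`. -/
theorem coeff_rescale_neg_binomialSeries_neg (a c : ℂ) (n : ℕ) :
    coeff n (rescale (-c) (binomialSeries ℂ (-a))) =
      (ascPochhammer ℂ n).eval a * c ^ n / n.factorial := by
  have h : (n.factorial : ℂ) * Ring.multichoose a n = (ascPochhammer ℂ n).eval a := by
    rw [← nsmul_eq_mul, Ring.factorial_nsmul_multichoose_eq_ascPochhammer,
      Polynomial.ascPochhammer_smeval_eq_eval]
  have hn : (n.factorial : ℂ) ≠ 0 := Nat.cast_ne_zero.mpr n.factorial_ne_zero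
  rw [coeff_rescale, binomialSeries_coeff, Ring.choose_neg', ← h, Units.smul_def, zsmul_eq_mul,
    Int.cast_negOnePow_natCast, smul_eq_mul, mul_one, neg_pow c, eq_div_iff hn]
  have hs : ((-1 : ℂ) ^ n) * (-1) ^ n = 1 := by rw [← mul_pow]; simp
  linear_combination (c ^ n * Ring.multichoose a n * n.factorial) * hs

open PowerSeries in
/-- The inverse of `(1 - c * t) ^ (-a)` is `(1 - c * t) ^ a`. -/
theorem rescale_binomialSeries_mul_neg (a c : ℂ) :
    rescale c (binomialSeries ℂ a) * rescale c (binomialSeries ℂ (-a)) = 1 := by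
  rw [← map_mul, ← binomialSeries_add, add_neg_cancel, binomialSeries_zero, map_one]

open PowerSeries in
/-- The generating function of the Meixner–Pollaczek polynomials. -/
theorem mk_meixnerPollaczek (lam x φ : ℝ) :
    PowerSeries.mk (meixnerPollaczek lam x φ) =
      rescale (-Complex.exp (I * φ)) (binomialSeries ℂ (-((lam : ℂ) - I * x))) *
        rescale (-Complex.exp (-(I * φ))) (binomialSeries ℂ (-((lam : ℂ) + I * x))) := by
  ext n
  rw [coeff_mk, coeff_mul, Finset.Nat.sum_antidiagonal_eq_sum_range_succ_mk, meixnerPollaczek]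
  refine Finset.sum_congr rfl fun k hk => ?_
  have hkn : k ≤ n := Finset.mem_range_succ_iff.mp hk
  rw [coeff_rescale_neg_binomialSeries_neg, coeff_rescale_neg_binomialSeries_neg,
    ← Complex.exp_nat_mul, ← Complex.exp_nat_mul, Nat.cast_sub hkn]
  ring_nf

open PowerSeries in
/-- If `mk f * mk g = 1`, then the lower triangular Toeplitz matrices of `f` and `g` are
inverse to each other. -/
theorem sum_Icc_mul_eq_ite_of_mk_mul_mk_eq_one {R : Type*} [Semiring R] {f g : ℕ → R}
    (h : PowerSeries.mk f * PowerSeries.mk g = 1) {i j : ℕ} (hij : j ≤ i) :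
    ∑ k ∈ Finset.Icc j i, f (i - k) * g (k - j) = if i = j then 1 else 0 := by
  obtain ⟨d, rfl⟩ := Nat.exists_eq_add_of_le hij
  have hd := congrArg (coeff d) h
  rw [coeff_mul, Finset.Nat.sum_antidiagonal_eq_sum_range_succ_mk, coeff_one,
    ← Finset.sum_range_reflect] at hd
  rw [← Finset.Ico_add_one_right_eq_Icc, Finset.sum_Ico_eq_sum_range,
    show j + d + 1 - j = d + 1 by lia]
  simp only [Nat.add_eq_left]
  rw [← hd]
  refine Finset.sum_congr rfl fun k hk => ?_
  have hkd : k ≤ d := Finset.mem_range_succ_iff.mp hk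
  simp only [coeff_mk]
  congr 2 <;> lia

/-- Inversion formulas for the Meixner–Pollaczek polynomials:
`∑_{k=j}^{i} P_{i-k}^{(-λ)}(-x;φ) P_{k-j}^{(λ)}(x;φ) = δ_{ij}` and, equivalently,
`∑_{k=j}^{i} P_{i-k}^{(-λ)}(x;-φ) P_{k-j}^{(λ)}(x;φ) = δ_{ij}`. -/
theorem meixnerPollaczek_inversion (lam x φ : ℝ) (i j : ℕ) (hij : j ≤ i) :
    (∑ k ∈ Finset.Icc j i,
        meixnerPollaczek (-lam) (-x) φ (i - k) * meixnerPollaczek lam x φ (k - j) =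
      if i = j then 1 else 0) ∧
    (∑ k ∈ Finset.Icc j i,
        meixnerPollaczek (-lam) x (-φ) (i - k) * meixnerPollaczek lam x φ (k - j) =
      if i = j then 1 else 0) := by
  have hmul : PowerSeries.mk (meixnerPollaczek (-lam) (-x) φ) *
      PowerSeries.mk (meixnerPollaczek lam x φ) = 1 := by
    have h₁ := rescale_binomialSeries_mul_neg ((lam : ℂ) - I * x) (-exp (I * φ))
    have h₂ := rescale_binomialSeries_mul_neg ((lam : ℂ) + I * x) (-exp (-(I * φ)))
    rw [mk_meixnerPollaczek, mk_meixnerPollaczek, mul_mul_mul_comm]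
    convert congrArg₂ (· * ·) h₁ h₂ using 5
    · push_cast; ring_nf
    · push_cast; ring_nf
    · simp
  have hsymm : PowerSeries.mk (meixnerPollaczek (-lam) x (-φ)) =
      PowerSeries.mk (meixnerPollaczek (-lam) (-x) φ) := by
    rw [mk_meixnerPollaczek, mk_meixnerPollaczek, mul_comm]
    simp [sub_eq_add_neg]
  exact ⟨sum_Icc_mul_eq_ite_of_mk_mul_mk_eq_one hmul hij,
    sum_Icc_mul_eq_ite_of_mk_mul_mk_eq_one (hsymm ▸ hmul) hij⟩
end

section
/- For every nonnegative integer n and every complex x, ∑_{k=0}^{n} H_k(x) · H_{n-k}(ix) · i^{n-k} equals 1 if n = 0 and equals 0 if n ≥ 1, where i is the imaginary unit. -/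
/-- The Hermite polynomial (normalization `exp(xt - t²/4) = ∑ H_n(x) tⁿ`), for a complex
argument: `H_n(x) = ∑_{k=0}^{⌊n/2⌋} (-1)^k x^{n-2k}/(4^k k! (n-2k)!)`. -/
noncomputable def hermite (n : ℕ) (x : ℂ) : ℂ :=
  ∑ k ∈ Finset.range (n / 2 + 1),
    (-1 : ℂ) ^ k * x ^ (n - 2 * k) /
      (4 ^ k * (Nat.factorial k) * (Nat.factorial (n - 2 * k)))

open PowerSeries in
theorem PowerSeries.rescale_expand {R : Type*} [CommRing R] (p : ℕ) (hp : p ≠ 0) (a : R)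
    (φ : R⟦X⟧) : rescale a (expand p hp φ) = expand p hp (rescale (a ^ p) φ) := by
  ext n
  rw [coeff_rescale]
  by_cases h : p ∣ n
  · obtain ⟨m, rfl⟩ := h
    rw [coeff_expand_mul, coeff_expand_mul, coeff_rescale, pow_mul]
  · rw [coeff_expand_of_not_dvd p hp _ h, coeff_expand_of_not_dvd p hp _ h, mul_zero]

open PowerSeries in
theorem PowerSeries.rescale_exp_mul_rescale_neg_exp {A : Type*} [CommRing A] [Algebra ℚ A]
    (a : A) : rescale a (exp A) * rescale (-a) (exp A) = 1 := by
  rw [exp_mul_exp_eq_exp_add, add_neg_cancel, rescale_zero_apply, constantCoeff_exp, map_one]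

open PowerSeries in
/-- The generating function `∑ Hₙ(x) tⁿ = exp(-t²/4) exp(xt)` as an identity of formal power
series. -/
theorem mk_hermite (x : ℂ) :
    mk (fun n => hermite n x) =
      expand 2 two_ne_zero (rescale (-1 / 4) (exp ℂ)) * rescale x (exp ℂ) := by
  ext n
  rw [coeff_mk, coeff_mul, Finset.Nat.sum_antidiagonal_eq_sum_range_succ_mk, hermite]
  symm
  have hsub : (Finset.range (n / 2 + 1)).image (2 * ·) ⊆ Finset.range (n + 1) := by
    intro i hi
    simp only [Finset.mem_image, Finset.mem_range] at hi ⊢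
    lia
  rw [← Finset.sum_subset hsub, Finset.sum_image (fun a _ b _ h => by simpa using h)]
  · refine Finset.sum_congr rfl fun k _ => ?_
    rw [coeff_expand_mul, coeff_rescale, coeff_rescale, coeff_exp, coeff_exp, div_pow]
    simp only [map_div₀, map_one, map_natCast]
    field_simp
  · intro i hi hi'
    rw [coeff_expand_of_not_dvd, zero_mul]
    rintro ⟨k, rfl⟩
    simp only [Finset.mem_image, Finset.mem_range] at hi hi'
    exact hi' ⟨k, by lia, rfl⟩

/-- `∑_{k=0}^{n} H_k(x) H_{n-k}(ix) i^{n-k} = δ_{n0}`. -/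
theorem hermite_inversion (n : ℕ) (x : ℂ) :
    ∑ k ∈ Finset.range (n + 1),
        hermite k x * hermite (n - k) (Complex.I * x) * Complex.I ^ (n - k) =
      if n = 0 then 1 else 0 := by
  open PowerSeries in
  have key : mk (fun n => hermite n x) *
      rescale Complex.I (mk fun n => hermite n (Complex.I * x)) = 1 := by
    rw [mk_hermite, mk_hermite, map_mul, rescale_expand, rescale_rescale, rescale_rescale,
      Complex.I_sq, mul_mul_mul_comm, ← map_mul, mul_neg_one, rescale_exp_mul_rescale_neg_exp,
      mul_right_comm, Complex.I_mul_I, neg_one_mul, rescale_exp_mul_rescale_neg_exp, map_one,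
      mul_one]
  have hn := congrArg (PowerSeries.coeff n) key
  rw [PowerSeries.coeff_mul, Finset.Nat.sum_antidiagonal_eq_sum_range_succ_mk,
    PowerSeries.coeff_one] at hn
  rw [← hn]
  refine Finset.sum_congr rfl fun k _ => ?_
  rw [PowerSeries.coeff_rescale, PowerSeries.coeff_mk, PowerSeries.coeff_mk]
  ring
end

section
/- Let {F_n}_{n=1}^∞ be a sequence of complex polynomials, and suppose {a_k}_{k=1}^∞ is a sequence of complex polynomials satisfying ∑_{k=1}^{n} a_k(x) · D^k H_n(x) = F_n(x) for all n = 1,2,3,… (the sum terminates since D^k H_n = 0 for k > n). Then the coefficients are uniquely determined and given by a_k(x) = ∑_{j=1}^{k} i^{k-j} H_{k-j}(ix) · F_j(x) for k = 1,2,3,…, where i is the imaginary unit. -/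
open Polynomial

/-- The Hermite polynomial (normalization `exp(xt - t²/4) = ∑ H_n(x) tⁿ`) as a polynomial
over `ℂ`: `H_n(x) = ∑_{k=0}^{⌊n/2⌋} (-1)^k x^{n-2k}/(4^k k! (n-2k)!)`. -/
noncomputable def hermitePoly (n : ℕ) : Polynomial ℂ :=
  ∑ k ∈ Finset.range (n / 2 + 1),
    Polynomial.C ((-1 : ℂ) ^ k /
      (4 ^ k * (Nat.factorial k) * (Nat.factorial (n - 2 * k)))) *
      Polynomial.X ^ (n - 2 * k)

theorem coeff_hermitePoly_add_two_mul (m k : ℕ) :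
    (hermitePoly (m + 2 * k)).coeff m =
      (-1 : ℂ) ^ k / (4 ^ k * (Nat.factorial k) * (Nat.factorial m)) := by
  rw [hermitePoly, finsetSum_coeff, Finset.sum_eq_single k]
  · simp [coeff_X_pow]
  · intro b hb hbk
    rw [Finset.mem_range] at hb
    rw [coeff_C_mul, coeff_X_pow, if_neg (by omega), mul_zero]
  · intro h
    exact absurd (Finset.mem_range.mpr (by omega)) h

theorem coeff_hermitePoly_eq_zero {n m : ℕ} (h : ∀ k, n ≠ m + 2 * k) :
    (hermitePoly n).coeff m = 0 := by
  rw [hermitePoly, finsetSum_coeff]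
  refine Finset.sum_eq_zero fun b hb => ?_
  rw [Finset.mem_range] at hb
  have := h b
  rw [coeff_C_mul, coeff_X_pow, if_neg (by omega), mul_zero]

theorem hermitePoly_zero : hermitePoly 0 = 1 := by
  simp [hermitePoly]

theorem hermitePoly_one : hermitePoly 1 = X := by
  simp [hermitePoly]

theorem derivative_hermitePoly_succ (n : ℕ) :
    derivative (hermitePoly (n + 1)) = hermitePoly n := by
  ext m
  rw [coeff_derivative]
  by_cases h : ∃ k, n = m + 2 * k
  · obtain ⟨k, rfl⟩ := h
    rw [show m + 2 * k + 1 = (m + 1) + 2 * k by ring, coeff_hermitePoly_add_two_mul,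
      coeff_hermitePoly_add_two_mul, Nat.factorial_succ]
    have hk : (k.factorial : ℂ) ≠ 0 := by exact_mod_cast k.factorial_ne_zero
    have hm : (m.factorial : ℂ) ≠ 0 := by exact_mod_cast m.factorial_ne_zero
    have hm' : (m : ℂ) + 1 ≠ 0 := by exact_mod_cast m.succ_ne_zero
    push_cast
    field_simp
  · push Not at h
    rw [coeff_hermitePoly_eq_zero h, coeff_hermitePoly_eq_zero, zero_mul]
    intro k hk
    exact h k (by omega)

theorem iterate_derivative_hermitePoly_add (n k : ℕ) :
    derivative^[k] (hermitePoly (n + k)) = hermitePoly n := by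
  induction k with
  | zero => rfl
  | succ k ih =>
    rw [Function.iterate_succ_apply, ← add_assoc, derivative_hermitePoly_succ, ih]

theorem hermitePoly_recurrence (n : ℕ) :
    hermitePoly (n + 2) * ((n : ℂ[X]) + 2) =
      X * hermitePoly (n + 1) - C (1 / 2 : ℂ) * hermitePoly n := by
  ext m
  have hcast : ((n : ℂ[X]) + 2) = C ((n : ℂ) + 2) := by
    rw [map_add, map_natCast, map_ofNat]
  rw [hcast, coeff_mul_C, coeff_sub, coeff_C_mul]
  by_cases h : ∃ k, n + 2 = m + 2 * k
  · obtain ⟨k, hk⟩ := h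
    have hn : (n : ℂ) + 2 = m + 2 * k := by exact_mod_cast hk
    have hX : (X * hermitePoly (n + 1)).coeff m =
        m * ((-1 : ℂ) ^ k / (4 ^ k * (Nat.factorial k) * (Nat.factorial m))) := by
      cases m with
      | zero => simp
      | succ m =>
        rw [coeff_X_mul, show n + 1 = m + 2 * k by omega, coeff_hermitePoly_add_two_mul,
          Nat.factorial_succ]
        have hk : (k.factorial : ℂ) ≠ 0 := by exact_mod_cast k.factorial_ne_zero
        have hm : (m.factorial : ℂ) ≠ 0 := by exact_mod_cast m.factorial_ne_zero
        have hm' : (m : ℂ) + 1 ≠ 0 := by exact_mod_cast m.succ_ne_zero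
        push_cast
        field_simp
    rw [hX, hn, hk, coeff_hermitePoly_add_two_mul]
    cases k with
    | zero =>
      rw [coeff_hermitePoly_eq_zero (fun k => by omega)]
      simp [mul_comm]
    | succ k =>
      rw [show n = m + 2 * k by omega, coeff_hermitePoly_add_two_mul, Nat.factorial_succ]
      have hk : (k.factorial : ℂ) ≠ 0 := by exact_mod_cast k.factorial_ne_zero
      have hm : (m.factorial : ℂ) ≠ 0 := by exact_mod_cast m.factorial_ne_zero
      have hk' : (k : ℂ) + 1 ≠ 0 := by exact_mod_cast k.succ_ne_zero
      push_cast
      field_simp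
      ring
  · push Not at h
    have hX : (X * hermitePoly (n + 1)).coeff m = 0 := by
      cases m with
      | zero => simp
      | succ m =>
        rw [coeff_X_mul, coeff_hermitePoly_eq_zero]
        intro k hk
        exact h k (by omega)
    rw [hX, coeff_hermitePoly_eq_zero h, coeff_hermitePoly_eq_zero]
    · simp
    · intro k hk
      exact h (k + 1) (by omega)

/-- A three-term recurrence for a sequence is a first-order differential equation for its
generating function. -/
theorem PowerSeries.derivative_mk_of_recurrence {R : Type*} [CommRing R] {f : ℕ → R} {p q : R}
    (h0 : f 1 = p * f 0) (h : ∀ n : ℕ, f (n + 2) * ((n : R) + 2) = p * f (n + 1) - q * f n) :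
    PowerSeries.derivative R (PowerSeries.mk f) =
      (PowerSeries.C p - PowerSeries.C q * PowerSeries.X) * PowerSeries.mk f := by
  ext n
  rw [PowerSeries.coeff_derivative, sub_mul, mul_assoc, map_sub,
    PowerSeries.coeff_C_mul, PowerSeries.coeff_C_mul]
  cases n with
  | zero => simp [h0]
  | succ n =>
    rw [PowerSeries.coeff_succ_X_mul]
    simp only [PowerSeries.coeff_mk]
    rw [← h n]
    push_cast
    ring

theorem PowerSeries.mk_mul_mk_eq_one_of_recurrence {R : Type*} [CommRing R]
    [IsAddTorsionFree R] {f g : ℕ → R} {p q : R} (hf0 : f 0 = 1) (hg0 : g 0 = 1)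
    (hf1 : f 1 = p) (hg1 : g 1 = -p)
    (hf : ∀ n : ℕ, f (n + 2) * ((n : R) + 2) = p * f (n + 1) - q * f n)
    (hg : ∀ n : ℕ, g (n + 2) * ((n : R) + 2) = -p * g (n + 1) - -q * g n) :
    PowerSeries.mk f * PowerSeries.mk g = 1 := by
  apply PowerSeries.derivative.ext
  · rw [Derivation.leibniz,
      PowerSeries.derivative_mk_of_recurrence (by rw [hf0, hf1, mul_one]) hf,
      PowerSeries.derivative_mk_of_recurrence (by rw [hg0, hg1, mul_one]) hg,
      Derivation.map_one_eq_zero, smul_eq_mul, smul_eq_mul, map_neg, map_neg]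
    ring
  · rw [map_mul, map_one]
    simp [← PowerSeries.coeff_zero_eq_constantCoeff_apply, hf0, hg0]

/-- The polynomial `iⁿ H_n(ix)`. -/
noncomputable def hermitePolyDual (n : ℕ) : ℂ[X] :=
  C (Complex.I ^ n) * (hermitePoly n).comp (C Complex.I * X)

theorem hermitePolyDual_zero : hermitePolyDual 0 = 1 := by
  simp [hermitePolyDual, hermitePoly_zero]

theorem hermitePolyDual_one : hermitePolyDual 1 = -X := by
  rw [hermitePolyDual, hermitePoly_one, X_comp, ← mul_assoc, ← C_mul]
  simp

theorem hermitePolyDual_recurrence (n : ℕ) :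
    hermitePolyDual (n + 2) * ((n : ℂ[X]) + 2) =
      -X * hermitePolyDual (n + 1) - -C (1 / 2 : ℂ) * hermitePolyDual n := by
  have h := congrArg (fun p : ℂ[X] => p.comp (C Complex.I * X)) (hermitePoly_recurrence n)
  simp only [mul_comp, add_comp, sub_comp, natCast_comp, ofNat_comp, X_comp, C_comp] at h
  have hI : (C Complex.I : ℂ[X]) ^ 2 = -1 := by
    rw [← C_pow, Complex.I_sq, C_neg, C_1]
  simp only [hermitePolyDual, C_pow]
  linear_combination C Complex.I ^ (n + 2) * h +
    (C Complex.I ^ n * (X * (hermitePoly (n + 1)).comp (C Complex.I * X) * C Complex.I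
      - C (1 / 2) * (hermitePoly n).comp (C Complex.I * X))) * hI

theorem mk_hermitePoly_mul_mk_hermitePolyDual :
    PowerSeries.mk hermitePoly * PowerSeries.mk hermitePolyDual = 1 :=
  PowerSeries.mk_mul_mk_eq_one_of_recurrence hermitePoly_zero hermitePolyDual_zero
    hermitePoly_one hermitePolyDual_one hermitePoly_recurrence hermitePolyDual_recurrence

theorem PowerSeries.coeff_mk_mul_mk_of_zero {R : Type*} [CommSemiring R] {f : ℕ → R}
    (hf : f 0 = 0) (g : ℕ → R) (n : ℕ) :
    PowerSeries.coeff n (PowerSeries.mk f * PowerSeries.mk g) =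
      ∑ k ∈ Finset.Icc 1 n, f k * g (n - k) := by
  rw [PowerSeries.coeff_mul]
  simp only [PowerSeries.coeff_mk]
  rw [Finset.Nat.sum_antidiagonal_eq_sum_range_succ (fun i j => f i * g j)]
  symm
  apply Finset.sum_subset
  · intro k hk
    rw [Finset.mem_Icc] at hk
    exact Finset.mem_range.mpr (by omega)
  · intro k hk hk'
    rw [Finset.mem_range] at hk
    rw [Finset.mem_Icc] at hk'
    obtain rfl : k = 0 := by omega
    rw [hf, zero_mul]

/-- If polynomials `a_k` satisfy `∑_{k=1}^{n} a_k(x) D^k H_n(x) = F_n(x)` for all `n ≥ 1`,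
then they are uniquely determined, given by `a_k(x) = ∑_{j=1}^{k} i^{k-j} H_{k-j}(ix) F_j(x)`. -/
theorem hermite_system_solution (F a : ℕ → Polynomial ℂ)
    (ha : ∀ n : ℕ, 1 ≤ n →
      ∑ k ∈ Finset.Icc 1 n, a k * (Polynomial.derivative^[k] (hermitePoly n)) = F n) :
    ∀ k : ℕ, 1 ≤ k →
      a k = ∑ j ∈ Finset.Icc 1 k,
        Polynomial.C (Complex.I ^ (k - j)) *
          (hermitePoly (k - j)).comp (Polynomial.C Complex.I * Polynomial.X) * F j := by
  have hupd : ∀ (f : ℕ → ℂ[X]) {k : ℕ}, 1 ≤ k → Function.update f 0 0 k = f k := fun f k hk =>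
    Function.update_of_ne (by omega) _ _
  have key : PowerSeries.mk (Function.update a 0 0) * PowerSeries.mk hermitePoly =
      PowerSeries.mk (Function.update F 0 0) := by
    ext1 n
    rw [PowerSeries.coeff_mk_mul_mk_of_zero (Function.update_self ..), PowerSeries.coeff_mk]
    rcases Nat.eq_zero_or_pos n with rfl | hn
    · simp
    · rw [hupd F hn, ← ha n hn]
      refine Finset.sum_congr rfl fun k hk => ?_
      rw [Finset.mem_Icc] at hk
      obtain ⟨m, rfl⟩ := Nat.exists_eq_add_of_le' hk.2
      rw [hupd a hk.1, iterate_derivative_hermitePoly_add, Nat.add_sub_cancel]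
  have inv : PowerSeries.mk (Function.update a 0 0) =
      PowerSeries.mk (Function.update F 0 0) * PowerSeries.mk hermitePolyDual := by
    rw [← key, mul_assoc, mk_hermitePoly_mul_mk_hermitePolyDual, mul_one]
  intro k hk
  have h := congrArg (PowerSeries.coeff k) inv
  rw [PowerSeries.coeff_mk_mul_mk_of_zero (Function.update_self ..), PowerSeries.coeff_mk,
    hupd a hk] at h
  rw [h]
  refine Finset.sum_congr rfl fun j hj => ?_
  rw [hupd F (Finset.mem_Icc.mp hj).1, mul_comm, hermitePolyDual]
end

section
/- Let α, β be real numbers such that α + β + s ≠ 0 for every positive integer s. Then for every nonnegative integer n and all real x, y, one has ∑_{k=0}^{n} [(α+β+2k+1)/((α+β+k+1)_{n+1})] · P_k^{(α,β)}(x) · P_{n-k}^{(-n-α-1,-n-β-1)}(y) = (1/n!) · ((x-y)/2)^n. -/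
theorem ascPochhammer_eval_add {R : Type*} [CommRing R] (n m : ℕ) (z : R) :
    (ascPochhammer R (n + m)).eval z =
      (ascPochhammer R n).eval z * (ascPochhammer R m).eval (z + n) := by
  simp [← ascPochhammer_mul, Polynomial.eval_comp]

theorem ascPochhammer_eval_one_sub_sub {R : Type*} [CommRing R] (n : ℕ) (z : R) :
    (ascPochhammer R n).eval (1 - z - n) = (-1) ^ n * (ascPochhammer R n).eval z := by
  rw [show 1 - z - n = -(z + n - 1) by ring, ascPochhammer_eval_neg_eq_descPochhammer,
    descPochhammer_eval_eq_ascPochhammer]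
  congr 2
  ring

theorem ascPochhammer_eval_ne_zero {R : Type*} [CommRing R] [IsDomain R] (n : ℕ) (z : R)
    (hz : ∀ s : ℕ, z + s ≠ 0) : (ascPochhammer R n).eval z ≠ 0 := by
  induction n with
  | zero => simp
  | succ n ih => rw [ascPochhammer_succ_eval]; exact mul_ne_zero ih (hz n)

theorem mul_sum_range_alternating_choose_div_ascPochhammer {K : Type*} [Field K] (a : K)
    (ha : ∀ s : ℕ, a + s ≠ 0) (N L : ℕ) (hL : L ≤ N + 1) :
    (N : K) * ∑ l ∈ Finset.range L,
        (-1) ^ l * (N.choose l : K) * (a + 2 * l) / (ascPochhammer K (N + 1)).eval (a + l) =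
      -((-1) ^ L * (L * N.choose L) / (ascPochhammer K N).eval (a + L)) := by
  induction L with
  | zero => simp
  | succ L ih =>
    have hs (M : ℕ) : ∀ s : ℕ, a + M + s ≠ 0 := fun s => by
      simpa [add_assoc] using ha (M + s)
    have h1 := ascPochhammer_eval_ne_zero N _ (hs L)
    have h2 := ascPochhammer_eval_ne_zero N _ (hs (L + 1))
    have h3 := hs L N
    have h4 := ha L
    have h5 := ascPochhammer_succ_eval N (a + (L : K))
    have h6 : (ascPochhammer K (N + 1)).eval (a + L) =
        (a + L) * (ascPochhammer K N).eval (a + (L + 1 : ℕ)) := by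
      rw [add_comm N 1, ascPochhammer_eval_add]
      simp [add_assoc]
    have hc : (N.choose (L + 1) : K) * ((L + 1 : ℕ) : K) = N.choose L * (N - L) := by
      rw [← Nat.cast_sub (by lia)]
      exact_mod_cast congrArg (Nat.cast (R := K)) (Nat.choose_succ_right_eq N L)
    rw [Finset.sum_range_succ, mul_add, ih (by lia), mul_comm ((L + 1 : ℕ) : K), hc]
    have e1 : ((ascPochhammer K N).eval (a + L))⁻¹ =
        (a + L + N) / (ascPochhammer K (N + 1)).eval (a + L) := by
      rw [h5]; field_simp
    have e2 : ((ascPochhammer K N).eval (a + (L + 1 : ℕ)))⁻¹ =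
        (a + L) / (ascPochhammer K (N + 1)).eval (a + L) := by
      rw [h6]; field_simp
    simp only [div_eq_mul_inv _ (Polynomial.eval _ (ascPochhammer K N)), e1, e2]
    ring

theorem sum_range_alternating_choose_div_ascPochhammer {K : Type*} [Field K] [CharZero K] (a : K)
    (ha : ∀ s : ℕ, a + s ≠ 0) (N : ℕ) :
    ∑ l ∈ Finset.range (N + 1),
        (-1) ^ l * (N.choose l : K) * (a + 2 * l) / (ascPochhammer K (N + 1)).eval (a + l) =
      if N = 0 then 1 else 0 := by
  split_ifs with hN
  · subst hN
    have h0 : a ≠ 0 := by simpa using ha 0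
    simp [h0]
  · have h := mul_sum_range_alternating_choose_div_ascPochhammer a ha N (N + 1) le_rfl
    simpa [hN] using h

/-- The general term of the triple sum obtained by expanding both Jacobi polynomials. -/
theorem jacobi_expansion_term (α β : ℝ) (hαβ : ∀ s : ℕ, 1 ≤ s → α + β + s ≠ 0) (X Y : ℝ)
    (i j l m : ℕ) :
    (α + β + 2 * (i + l : ℕ) + 1) /
          ((ascPochhammer ℝ (i + l + j + m + 1)).eval (α + β + (i + l : ℕ) + 1)) *
        ((ascPochhammer ℝ i).eval (((i + l : ℕ) : ℝ) + α + β + 1) / i.factorial *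
          ((ascPochhammer ℝ l).eval (α + i + 1) / l.factorial) * X ^ i) *
        ((ascPochhammer ℝ j).eval (((j + m : ℕ) : ℝ) + (-((i + l + j + m : ℕ) : ℝ) - α - 1) +
            (-((i + l + j + m : ℕ) : ℝ) - β - 1) + 1) / j.factorial *
          ((ascPochhammer ℝ m).eval ((-((i + l + j + m : ℕ) : ℝ) - α - 1) + j + 1) /
            m.factorial) * Y ^ j) =
      (-1) ^ (i + (i + l + j + m)) * (ascPochhammer ℝ (l + m)).eval (α + i + 1) * X ^ i * Y ^ j /
          (i.factorial * j.factorial * (l + m).factorial) *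
        ((-1) ^ l * ((l + m).choose l : ℝ) * ((α + β + 2 * i + 1) + 2 * l) /
          (ascPochhammer ℝ (l + m + 1)).eval ((α + β + 2 * i + 1) + l)) := by
  set c := α + β with hc
  have hden : (ascPochhammer ℝ (i + l + j + m + 1)).eval (c + (i + l : ℕ) + 1) =
      (ascPochhammer ℝ i).eval (c + (i + l : ℕ) + 1) *
        (ascPochhammer ℝ (l + m + 1)).eval (c + 2 * i + 1 + l) *
        (ascPochhammer ℝ j).eval (c + 2 * i + 2 * l + m + 2) := by
    rw [show i + l + j + m + 1 = i + (l + m + 1) + j by lia, ascPochhammer_eval_add,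
      ascPochhammer_eval_add]
    have hB : c + (i + l : ℕ) + 1 + i = c + 2 * i + 1 + l := by push_cast; ring
    have hC : c + (i + l : ℕ) + 1 + (i + (l + m + 1) : ℕ) = c + 2 * i + 2 * l + m + 2 := by
      push_cast; ring
    rw [hB, hC]
  have hne : (ascPochhammer ℝ (i + l + j + m + 1)).eval (c + (i + l : ℕ) + 1) ≠ 0 := by
    refine ascPochhammer_eval_ne_zero _ _ fun s => ?_
    have := hαβ (i + l + 1 + s) (by lia)
    push_cast at this ⊢
    simpa [add_assoc] using this
  have e1 : ((i + l : ℕ) : ℝ) + α + β + 1 = c + (i + l : ℕ) + 1 := by rw [hc]; ring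
  have e2 : ((j + m : ℕ) : ℝ) + (-((i + l + j + m : ℕ) : ℝ) - α - 1) +
      (-((i + l + j + m : ℕ) : ℝ) - β - 1) + 1 = 1 - (c + 2 * i + 2 * l + m + 2) - j := by
    rw [hc]; push_cast; ring
  have e3 : (-((i + l + j + m : ℕ) : ℝ) - α - 1) + j + 1 = 1 - (α + i + 1 + l) - m := by
    push_cast; ring
  have hch : ((l + m).choose l : ℝ) = (l + m).factorial / (l.factorial * m.factorial) :=
    Nat.cast_add_choose ℝ
  have hsgn : (-1 : ℝ) ^ (i + (i + l + j + m)) * (-1) ^ l = (-1) ^ j * (-1) ^ m := by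
    rw [← pow_add, ← pow_add, show i + (i + l + j + m) + l = 2 * (i + l) + (j + m) by ring,
      pow_add, pow_mul]
    simp
  rw [e1, e2, e3, ascPochhammer_eval_one_sub_sub, ascPochhammer_eval_one_sub_sub, hch,
    ascPochhammer_eval_add l m]
  rw [hden] at hne ⊢
  obtain ⟨⟨h1, h2⟩, h3⟩ : (_ ≠ (0 : ℝ) ∧ _ ≠ (0 : ℝ)) ∧ _ ≠ (0 : ℝ) := by
    simpa only [mul_ne_zero_iff] using hne
  have f1 : (i.factorial : ℝ) ≠ 0 := by positivity
  have f2 : (j.factorial : ℝ) ≠ 0 := by positivity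
  have f3 : (l.factorial : ℝ) ≠ 0 := by positivity
  have f4 : (m.factorial : ℝ) ≠ 0 := by positivity
  have f5 : ((l + m).factorial : ℝ) ≠ 0 := by positivity
  generalize (ascPochhammer ℝ i).eval (c + (i + l : ℕ) + 1) = A at *
  generalize (ascPochhammer ℝ (l + m + 1)).eval (c + 2 * i + 1 + l) = B at *
  generalize (ascPochhammer ℝ j).eval (c + 2 * i + 2 * l + m + 2) = C at *
  generalize (ascPochhammer ℝ l).eval (α + i + 1) = D
  generalize (ascPochhammer ℝ m).eval (α + i + 1 + l) = E
  generalize (-1 : ℝ) ^ (i + (i + l + j + m)) = S at *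
  generalize (-1 : ℝ) ^ l = S1 at *
  generalize (-1 : ℝ) ^ j = S2 at *
  generalize (-1 : ℝ) ^ m = S3 at *
  push_cast
  field_simp
  linear_combination (-(c + 2 * (i + l) + 1) * D * X ^ i * E * Y ^ j) * hsgn

theorem sum_range_triangle_comm {M : Type*} [AddCommMonoid M] (n : ℕ) (f : ℕ → ℕ → ℕ → M) :
    ∑ k ∈ Finset.range (n + 1), ∑ i ∈ Finset.range (k + 1), ∑ j ∈ Finset.range (n - k + 1),
        f k i j =
      ∑ i ∈ Finset.range (n + 1), ∑ j ∈ Finset.range (n - i + 1),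
        ∑ l ∈ Finset.range (n - i - j + 1), f (i + l) i j := by
  simp only [Finset.sum_sigma']
  refine Finset.sum_nbij' (fun p => ⟨p.2.1, p.2.2, p.1 - p.2.1⟩)
    (fun p => ⟨p.1 + p.2.2, p.1, p.2.1⟩) ?_ ?_ ?_ ?_ ?_
  · rintro ⟨k, i, j⟩ h
    simp only [Finset.mem_sigma, Finset.mem_range] at h ⊢
    lia
  · rintro ⟨i, j, l⟩ h
    simp only [Finset.mem_sigma, Finset.mem_range] at h ⊢
    lia
  · rintro ⟨k, i, j⟩ h
    simp only [Finset.mem_sigma, Finset.mem_range] at h ⊢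
    rw [Nat.add_sub_cancel' (by lia)]
  · rintro ⟨i, j, l⟩ h
    simp
  · rintro ⟨k, i, j⟩ h
    simp only [Finset.mem_sigma, Finset.mem_range] at h ⊢
    rw [Nat.add_sub_cancel' (by lia)]

/-- If `α + β + s ≠ 0` for every positive integer `s`, then
`∑_{k=0}^{n} (α+β+2k+1)/((α+β+k+1)_{n+1}) P_k^{(α,β)}(x) P_{n-k}^{(-n-α-1,-n-β-1)}(y)
 = (1/n!)((x-y)/2)^n`. -/
theorem jacobi_two_variable_identity (α β : ℝ)
    (hαβ : ∀ s : ℕ, 1 ≤ s → α + β + s ≠ 0) (n : ℕ) (x y : ℝ) :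
    ∑ k ∈ Finset.range (n + 1),
        (α + β + 2 * k + 1) / ((ascPochhammer ℝ (n + 1)).eval (α + β + k + 1)) *
          jacobi α β k x * jacobi (-(n : ℝ) - α - 1) (-(n : ℝ) - β - 1) (n - k) y =
      (1 / (Nat.factorial n : ℝ)) * ((x - y) / 2) ^ n := by
  have key : ∀ i ∈ Finset.range (n + 1), ∀ j ∈ Finset.range (n - i + 1),
      ∑ l ∈ Finset.range (n - i - j + 1),
        (α + β + 2 * (i + l : ℕ) + 1) /
            ((ascPochhammer ℝ (n + 1)).eval (α + β + (i + l : ℕ) + 1)) *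
          ((ascPochhammer ℝ i).eval (((i + l : ℕ) : ℝ) + α + β + 1) / i.factorial *
            ((ascPochhammer ℝ (i + l - i)).eval (α + i + 1) / (i + l - i).factorial) *
            ((x - 1) / 2) ^ i) *
          ((ascPochhammer ℝ j).eval (((n - (i + l) : ℕ) : ℝ) + (-(n : ℝ) - α - 1) +
              (-(n : ℝ) - β - 1) + 1) / j.factorial *
            ((ascPochhammer ℝ (n - (i + l) - j)).eval ((-(n : ℝ) - α - 1) + j + 1) /
              (n - (i + l) - j).factorial) * ((y - 1) / 2) ^ j) =
        if j = n - i then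
          (-1) ^ (i + n) * ((x - 1) / 2) ^ i * ((y - 1) / 2) ^ j / (i.factorial * j.factorial)
        else 0 := by
    intro i hi j hj
    rw [Finset.mem_range] at hi hj
    obtain ⟨N, rfl⟩ : ∃ N, n = i + j + N := ⟨n - i - j, by lia⟩
    have hN : i + j + N - i - j = N := by lia
    have ha : ∀ s : ℕ, α + β + 2 * i + 1 + s ≠ 0 := fun s => by
      have := hαβ (2 * i + 1 + s) (by lia)
      push_cast at this
      simpa [add_assoc] using this
    rw [hN]
    trans (-1) ^ (i + (i + j + N)) * (ascPochhammer ℝ N).eval (α + i + 1) *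
          ((x - 1) / 2) ^ i * ((y - 1) / 2) ^ j / (i.factorial * j.factorial * N.factorial) *
        if N = 0 then 1 else 0
    · rw [← sum_range_alternating_choose_div_ascPochhammer _ ha N, Finset.mul_sum]
      refine Finset.sum_congr rfl fun l hl => ?_
      obtain ⟨m, rfl⟩ : ∃ m, N = l + m := ⟨N - l, by rw [Finset.mem_range] at hl; lia⟩
      rw [show i + j + (l + m) = i + l + j + m by lia, ← jacobi_expansion_term α β hαβ,
        show i + l + j + m - (i + l) = j + m by lia, Nat.add_sub_cancel_left,
        Nat.add_sub_cancel_left]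
    · by_cases h : N = 0
      · subst h
        simp
      · rw [if_neg h, if_neg (by lia), mul_zero]
  simp only [jacobi, Finset.mul_sum, Finset.sum_mul]
  rw [Finset.sum_congr rfl fun k _ => Finset.sum_comm, sum_range_triangle_comm,
    Finset.sum_congr rfl fun i hi => Finset.sum_congr rfl (key i hi),
    show (x - y) / 2 = (x - 1) / 2 + -((y - 1) / 2) by ring, add_pow, Finset.mul_sum]
  refine Finset.sum_congr rfl fun i hi => ?_
  rw [Finset.sum_ite_eq', if_pos (by simp)]
  have hin : i ≤ n := Finset.mem_range_succ_iff.mp hi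
  rw [Nat.cast_choose ℝ hin, neg_pow ((y - 1) / 2), show i + n = 2 * i + (n - i) by lia, pow_add,
    pow_mul]
  have : (n.factorial : ℝ) ≠ 0 := by positivity
  field_simp
  simp
end
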